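/- arXiv:math/0006031 — 2 statements merged into one kernel-verified Lean document; each statement's English description precedes it below -/
import Mathlib

section
/- For every integer n ≥ 2 and every R > 0 there exist constants ρ > 0 and c > 0, depending only on R and n, with the following property. For every E ∈ 𝒰_R ⊆ ℝⁿ, every p₀ ∈ ∂E with admissible centers p₀′, p₀′′, and every affine isometry g of ℝⁿ with g(0) = p₀ and g(eₙ) − g(0) = (p₀′′ − p₀′)/(2R), setting C := {x ∈ ℝ^{n−1} : |x| < ρ} × (−R, R), there exists a function f : {x ∈ ℝ^{n−1} : |x| < ρ} → ℝ such that ∂E ∩ g(C) = g({(x, f(x)) : |x| < ρ}) and E ∩ g(C) = g({(x, z) ∈ C : z ≤ f(x)}); moreover f(0) = 0, f is differentiable with ∇f(0) = 0, sup|f| ≤ c, sup|∇f| ≤ c, and ∇f is Lipschitz with Lipschitz constant at most c. -/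
open Set Metric MeasureTheory Filter Topology ENNReal NNReal

noncomputable section

abbrev En (n : ℕ) := EuclideanSpace ℝ (Fin n)

def sphereCond (n : ℕ) (R : ℝ) (E : Set (En n)) : Prop :=
  ∀ p ∈ frontier E, ∃ p' p'' : En n, dist p p' = R ∧ dist p p'' = R ∧
    ball p' R ⊆ E ∧ ball p'' R ∩ E = ∅

def UR (n : ℕ) (R : ℝ) : Set (Set (En n)) :=
  {E | IsClosed E ∧ Bornology.IsBounded E ∧ sphereCond n R E}

/-- The point of `ℝⁿ` with horizontal coordinates `x ∈ ℝ^{n-1}` and vertical coordinate `z`;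
in particular `emb n 0 1` is the `n`-th standard basis vector `eₙ`. -/
def emb (n : ℕ) (x : En (n - 1)) (z : ℝ) : En n :=
  (WithLp.equiv 2 (Fin n → ℝ)).symm (fun i => if h : (i : ℕ) < n - 1 then x ⟨i, h⟩ else z)

section SphereNormal

variable {V : Type*} [NormedAddCommGroup V] [InnerProductSpace ℝ V] {E : Set V} {R : ℝ}
  {p q ν μ : V}

/-- The unit vector `ν` is an outer normal of `E` at `p` in the sense of the two-sided sphere
condition with radius `R`. -/
def IsSphereNormal (E : Set V) (R : ℝ) (p ν : V) : Prop :=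
  ‖ν‖ = 1 ∧ ball (p - R • ν) R ⊆ E ∧ Disjoint (ball (p + R • ν) R) E

theorem two_mul_le_dist_of_disjoint_ball {a b : V} {r : ℝ}
    (h : Disjoint (ball a r) (ball b r)) : 2 * r ≤ dist a b := by
  by_contra! hlt
  refine Set.disjoint_left.1 h (?_ : midpoint ℝ a b ∈ _) ?_
  · rw [mem_ball, dist_midpoint_left, Real.norm_ofNat]
    linarith
  · rw [mem_ball, dist_midpoint_right, Real.norm_ofNat]
    linarith

theorem isSphereNormal_of_admissible (hR : 0 < R) {p' p'' : V} (h' : dist p p' = R)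
    (h'' : dist p p'' = R) (hin : ball p' R ⊆ E) (hout : ball p'' R ∩ E = ∅) :
    p'' - p = p - p' ∧ IsSphereNormal E R p (R⁻¹ • (p'' - p)) := by
  have hd : 2 * R ≤ dist p' p'' := two_mul_le_dist_of_disjoint_ball
    ((Set.disjoint_iff_inter_eq_empty.2 hout).symm.mono_left hin)
  have hopp : p'' - p = p - p' := by
    rw [dist_eq_norm] at h' hd
    rw [dist_comm, dist_eq_norm] at h''
    have hpar := parallelogram_law_with_norm ℝ (p'' - p) (p - p')
    rw [h', h'', show p'' - p + (p - p') = -(p' - p'') by abel, norm_neg] at hpar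
    have h0 : ‖p'' - p - (p - p')‖ = 0 := by
      have := norm_nonneg (p'' - p - (p - p'))
      nlinarith
    exact sub_eq_zero.1 (norm_eq_zero.1 h0)
  refine ⟨hopp, ?_, ?_, ?_⟩
  · rw [norm_smul, ← dist_eq_norm, dist_comm, h'', norm_inv, Real.norm_of_nonneg hR.le,
      inv_mul_cancel₀ hR.ne']
  · rwa [smul_inv_smul₀ hR.ne', hopp, _root_.sub_sub_cancel]
  · rw [smul_inv_smul₀ hR.ne', add_sub_cancel]
    exact Set.disjoint_iff_inter_eq_empty.2 hout

theorem IsSphereNormal.norm_sub_le (hR : 0 < R) (hν : IsSphereNormal E R p ν)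
    (hμ : IsSphereNormal E R q μ) : ‖ν - μ‖ ≤ ‖p - q‖ / R := by
  have h₁ := two_mul_le_dist_of_disjoint_ball (hν.2.2.symm.mono_left hμ.2.1)
  have h₂ := two_mul_le_dist_of_disjoint_ball (hμ.2.2.symm.mono_left hν.2.1)
  rw [dist_comm, dist_eq_norm,
    show p + R • ν - (q - R • μ) = (p - q) + R • (ν + μ) by rw [smul_add]; abel] at h₁
  rw [dist_eq_norm,
    show p - R • ν - (q + R • μ) = (p - q) - R • (ν + μ) by rw [smul_add]; abel] at h₂
  have hpar := parallelogram_law_with_norm ℝ (p - q) (R • (ν + μ))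
  have hpar' := parallelogram_law_with_norm ℝ ν μ
  rw [norm_smul, Real.norm_of_nonneg hR.le] at hpar
  rw [hν.1, hμ.1] at hpar'
  have hsq : (R * ‖ν - μ‖) ^ 2 ≤ ‖p - q‖ ^ 2 := by
    have e₁ := mul_self_le_mul_self (by positivity) h₁
    have e₂ := mul_self_le_mul_self (by positivity) h₂
    linear_combination (e₁ + e₂ + hpar) / 2 + R ^ 2 * hpar'
  rw [le_div_iff₀ hR, mul_comm]
  exact le_of_sq_le_sq hsq (norm_nonneg _)

theorem IsSphereNormal.abs_inner_le (hE : IsClosed E) (hν : IsSphereNormal E R p ν)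
    (hR : 0 < R) (hq : q ∈ frontier E) : 2 * R * |inner ℝ ν (q - p)| ≤ ‖q - p‖ ^ 2 := by
  have hin : q ∉ ball (p - R • ν) R := fun h =>
    hq.2 (interior_maximal hν.2.1 isOpen_ball h)
  have hout : q ∉ ball (p + R • ν) R := fun h =>
    Set.disjoint_left.1 hν.2.2 h (hE.frontier_subset hq)
  rw [mem_ball, not_lt, dist_eq_norm] at hin hout
  rw [show q - (p - R • ν) = (q - p) + R • ν by abel] at hin
  rw [show q - (p + R • ν) = (q - p) - R • ν by abel] at hout
  have e₁ := pow_le_pow_left₀ hR.le hin 2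
  have e₂ := pow_le_pow_left₀ hR.le hout 2
  rw [norm_add_sq_real, norm_smul, hν.1, inner_smul_right, Real.norm_of_nonneg hR.le,
    real_inner_comm] at e₁
  rw [norm_sub_sq_real, norm_smul, hν.1, inner_smul_right, Real.norm_of_nonneg hR.le,
    real_inner_comm] at e₂
  rcases abs_cases (inner ℝ ν (q - p)) with h | h <;> rw [h.1] <;> linarith

theorem IsPreconnected.inter_frontier_nonempty_of_mem {X : Type*} [TopologicalSpace X]
    {s E : Set X} (hs : IsPreconnected s) {a b : X} (ha : a ∈ s) (hb : b ∈ s) (haE : a ∈ E)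
    (hbE : b ∉ E) : ∃ x ∈ s, x ∈ frontier E := by
  by_contra! h
  have hsub : s ⊆ interior E := hs.subset_left_of_subset_union isOpen_interior
    isClosed_closure.isOpen_compl
    (disjoint_compl_right.mono_left (interior_subset.trans subset_closure))
    (fun x hx => by
      by_cases hc : x ∈ closure E
      · exact Or.inl (by_contra fun hi => h x hx ⟨hc, hi⟩)
      · exact Or.inr hc)
    ⟨a, ha, by_contra fun hi => h a ha ⟨subset_closure haE, hi⟩⟩
  exact hbE (interior_subset (hsub hb))

end SphereNormal

theorem exists_mem_frontier_of_vertical {F : Type*} [NormedAddCommGroup F]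
    {E : Set (WithLp 2 (F × ℝ))} {x : F} {a b : ℝ} (ha : WithLp.toLp 2 (x, a) ∈ E)
    (hb : WithLp.toLp 2 (x, b) ∉ E) : ∃ z ∈ uIcc a b, WithLp.toLp 2 (x, z) ∈ frontier E := by
  have hc : Continuous fun z : ℝ => WithLp.toLp 2 (x, z) :=
    (WithLp.prod_continuous_toLp 2 F ℝ).comp (by fun_prop)
  obtain ⟨_, ⟨z, hz, rfl⟩, hzE⟩ :=
    (isPreconnected_uIcc.image _ hc.continuousOn).inter_frontier_nonempty_of_mem
      (mem_image_of_mem _ left_mem_uIcc) (mem_image_of_mem _ right_mem_uIcc) ha hb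
  exact ⟨z, hz, hzE⟩

theorem abs_inv_le_of_le {b : ℝ} (hb : 27 / 32 ≤ b) : |b⁻¹| ≤ 6 / 5 := by
  rw [abs_of_pos (inv_pos.2 (by linarith)), inv_le_comm₀ (by linarith) (by norm_num)]
  linarith

section Graph

variable {F : Type*} [NormedAddCommGroup F] [InnerProductSpace ℝ F]
  {E : Set (WithLp 2 (F × ℝ))} {R : ℝ} {p q ν μ : WithLp 2 (F × ℝ)}

theorem abs_snd_le_of_mem_frontier (hR : 0 < R) (hE : IsClosed E)
    (h₀ : IsSphereNormal E R 0 (WithLp.toLp 2 (0, 1))) (hp : p ∈ frontier E)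
    (hx : ‖p.fst‖ < R / 2) (hz : |p.snd| ≤ R) : |p.snd| ≤ R / 4 := by
  have h := h₀.abs_inner_le hE hR hp
  rw [sub_zero, WithLp.prod_inner_apply, WithLp.prod_norm_sq_eq_of_L2] at h
  simp only [WithLp.ofLp_fst, WithLp.ofLp_snd, inner_zero_left, zero_add, RCLike.inner_apply,
    conj_trivial, mul_one, Real.norm_eq_abs] at h
  have hn := norm_nonneg p.fst
  have ha := abs_nonneg p.snd
  by_contra! hlt
  nlinarith

theorem le_snd_of_isSphereNormal (hR : 0 < R) (hE : IsClosed E)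
    (h₀ : IsSphereNormal E R 0 (WithLp.toLp 2 (0, 1))) (hp : p ∈ frontier E)
    (hx : ‖p.fst‖ < R / 2) (hz : |p.snd| ≤ R) (hν : IsSphereNormal E R p ν) :
    27 / 32 ≤ ν.snd := by
  have hz' := abs_snd_le_of_mem_frontier hR hE h₀ hp hx hz
  have h := hν.norm_sub_le hR h₀
  rw [sub_zero, le_div_iff₀ hR] at h
  have hp2 := WithLp.prod_norm_sq_eq_of_L2 p
  have hd2 := WithLp.prod_norm_sq_eq_of_L2 (ν - WithLp.toLp 2 (0, 1))
  have hν2 := WithLp.prod_norm_sq_eq_of_L2 ν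
  rw [hν.1] at hν2
  simp only [WithLp.sub_fst, WithLp.sub_snd, WithLp.toLp_fst, WithLp.toLp_snd, sub_zero,
    Real.norm_eq_abs, sq_abs] at hp2 hd2 hν2
  have hps : ‖p‖ ^ 2 ≤ 5 / 16 * R ^ 2 := by
    have := pow_le_pow_left₀ (norm_nonneg _) hx.le 2
    have := pow_le_pow_left₀ (abs_nonneg _) hz' 2
    rw [sq_abs] at this
    linarith
  have hs := pow_le_pow_left₀ (by positivity) h 2
  have : ‖ν - WithLp.toLp 2 (0, 1)‖ ^ 2 ≤ 5 / 16 := by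
    refine le_of_mul_le_mul_right ?_ (pow_pos hR 2)
    linarith
  linarith

theorem graph_estimates (hR : 0 < R) (hE : IsClosed E)
    (h₀ : IsSphereNormal E R 0 (WithLp.toLp 2 (0, 1))) (hp : p ∈ frontier E)
    (hx : ‖p.fst‖ < R / 2) (hz : |p.snd| ≤ R) (hν : IsSphereNormal E R p ν)
    (hq : q ∈ frontier E) (hxq : ‖q.fst‖ < R / 2) (hzq : |q.snd| ≤ R) :
    |q.snd - p.snd| ≤ 3 * ‖q.fst - p.fst‖ ∧
      |inner ℝ ν.fst (q.fst - p.fst) + ν.snd * (q.snd - p.snd)|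
        ≤ 5 / R * ‖q.fst - p.fst‖ ^ 2 := by
  have hb := le_snd_of_isSphereNormal hR hE h₀ hp hx hz hν
  have hzp' := abs_snd_le_of_mem_frontier hR hE h₀ hp hx hz
  have hzq' := abs_snd_le_of_mem_frontier hR hE h₀ hq hxq hzq
  have h := hν.abs_inner_le hE hR hq
  have ha : ‖ν.fst‖ ≤ 1 := (WithLp.norm_fst_le _ ν).trans hν.1.le
  rw [WithLp.prod_inner_apply, WithLp.prod_norm_sq_eq_of_L2] at h
  simp only [WithLp.ofLp_fst, WithLp.ofLp_snd, WithLp.sub_fst, WithLp.sub_snd,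
    RCLike.inner_apply, conj_trivial, Real.norm_eq_abs] at h
  rw [mul_comm (q.snd - p.snd)] at h
  have hi := (abs_real_inner_le_norm ν.fst (q.fst - p.fst)).trans
    (mul_le_of_le_one_left (norm_nonneg _) ha)
  have hd : ‖q.fst - p.fst‖ ≤ R := by linarith [norm_sub_le q.fst p.fst]
  have hΔ : |q.snd - p.snd| ≤ R / 2 := by linarith [abs_sub q.snd p.snd]
  have hbΔ : 27 / 32 * |q.snd - p.snd| ≤ |ν.snd * (q.snd - p.snd)| := by
    rw [abs_mul]
    exact mul_le_mul_of_nonneg_right (hb.trans (le_abs_self _)) (abs_nonneg _)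
  have htri : |ν.snd * (q.snd - p.snd)| ≤
      |inner ℝ ν.fst (q.fst - p.fst) + ν.snd * (q.snd - p.snd)|
        + |inner ℝ ν.fst (q.fst - p.fst)| := by
    simpa using abs_sub (inner ℝ ν.fst (q.fst - p.fst) + ν.snd * (q.snd - p.snd))
      (inner ℝ ν.fst (q.fst - p.fst))
  have hdn := norm_nonneg (q.fst - p.fst)
  have hΔn := abs_nonneg (q.snd - p.snd)
  set d := ‖q.fst - p.fst‖
  set D := |q.snd - p.snd|
  set I := |inner ℝ ν.fst (q.fst - p.fst) + ν.snd * (q.snd - p.snd)|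
  have h1 : D ≤ 3 * d := by
    have hI : 2 * I ≤ d + D / 2 := by
      refine le_of_mul_le_mul_left ?_ hR
      nlinarith
    linarith
  refine ⟨h1, ?_⟩
  rw [div_mul_eq_mul_div, le_div_iff₀ hR]
  nlinarith

theorem norm_inv_smul_sub_le (hν : ‖ν‖ = 1) (hνb : 27 / 32 ≤ ν.snd) (hμb : 27 / 32 ≤ μ.snd) :
    ‖ν.snd⁻¹ • ν.fst - μ.snd⁻¹ • μ.fst‖ ≤ 3 * ‖ν - μ‖ := by
  have hνp : 0 < ν.snd := by linarith
  have hμp : 0 < μ.snd := by linarith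
  have hsplit : ν.snd⁻¹ • ν.fst - μ.snd⁻¹ • μ.fst =
      μ.snd⁻¹ • (ν - μ).fst + (ν.snd⁻¹ * μ.snd⁻¹ * (μ - ν).snd) • ν.fst := by
    have : ν.snd⁻¹ * μ.snd⁻¹ * (μ - ν).snd = ν.snd⁻¹ - μ.snd⁻¹ := by
      rw [WithLp.sub_snd]
      field_simp
    rw [this, WithLp.sub_fst, smul_sub, sub_smul]
    abel
  have h₁ : ‖(ν - μ).fst‖ ≤ ‖ν - μ‖ := WithLp.norm_fst_le _ _
  have h₂ : |(μ - ν).snd| ≤ ‖ν - μ‖ := norm_sub_rev ν μ ▸ WithLp.norm_snd_le _ (μ - ν)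
  have h₃ : ‖ν.fst‖ ≤ 1 := (WithLp.norm_fst_le _ ν).trans hν.le
  rw [hsplit]
  calc _ ≤ |μ.snd⁻¹| * ‖(ν - μ).fst‖ + |ν.snd⁻¹| * |μ.snd⁻¹| * |(μ - ν).snd| * ‖ν.fst‖ := by
        refine (norm_add_le _ _).trans_eq ?_
        rw [norm_smul, norm_smul, norm_mul, norm_mul]
        rfl
    _ ≤ 6 / 5 * ‖ν - μ‖ + 6 / 5 * (6 / 5) * ‖ν - μ‖ * 1 := by
        gcongr <;> exact abs_inv_le_of_le ‹_›
    _ ≤ 3 * ‖ν - μ‖ := by linarith [norm_nonneg (ν - μ)]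

theorem mem_of_isSphereNormal_zero (h₀ : IsSphereNormal E R 0 (WithLp.toLp 2 (0, 1))) {x : F}
    (hx : ‖x‖ < R) : WithLp.toLp 2 (x, -R) ∈ E := by
  refine h₀.2.1 ?_
  rwa [mem_ball, dist_eq_norm, show WithLp.toLp 2 (x, -R) - (0 - R • WithLp.toLp 2 ((0 : F), (1 : ℝ)))
    = WithLp.toLp 2 (x, 0) by simp [← WithLp.toLp_smul, ← WithLp.toLp_add], WithLp.norm_toLp_fst]

theorem notMem_of_isSphereNormal_zero (h₀ : IsSphereNormal E R 0 (WithLp.toLp 2 (0, 1))) {x : F}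
    (hx : ‖x‖ < R) : WithLp.toLp 2 (x, R) ∉ E := by
  refine Set.disjoint_left.1 h₀.2.2 ?_
  rwa [mem_ball, dist_eq_norm, show WithLp.toLp 2 (x, R) - (0 + R • WithLp.toLp 2 ((0 : F), (1 : ℝ)))
    = WithLp.toLp 2 (x, 0) by simp [← WithLp.toLp_smul, ← WithLp.toLp_sub], WithLp.norm_toLp_fst]

theorem eq_of_mem_frontier_of_vertical (hR : 0 < R) (hE : IsClosed E)
    (hN : ∀ p ∈ frontier E, ∃ ν, IsSphereNormal E R p ν)
    (h₀ : IsSphereNormal E R 0 (WithLp.toLp 2 (0, 1))) {x : F} (hx : ‖x‖ < R / 2) {z w : ℝ}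
    (hz : |z| ≤ R) (hw : |w| ≤ R) (hzE : WithLp.toLp 2 (x, z) ∈ frontier E)
    (hwE : WithLp.toLp 2 (x, w) ∈ frontier E) : z = w := by
  obtain ⟨ν, hν⟩ := hN _ hwE
  have h := (graph_estimates hR hE h₀ hwE hx hw hν hzE hx hz).1
  simp only [WithLp.toLp_fst, WithLp.toLp_snd, sub_self, norm_zero, mul_zero] at h
  exact sub_eq_zero.1 (abs_eq_zero.1 (le_antisymm h (abs_nonneg _)))

theorem exists_height (hR : 0 < R) (hE : IsClosed E)
    (hN : ∀ p ∈ frontier E, ∃ ν, IsSphereNormal E R p ν)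
    (h₀ : IsSphereNormal E R 0 (WithLp.toLp 2 (0, 1))) {x : F} (hx : ‖x‖ < R / 2) :
    ∃ t, |t| ≤ R / 4 ∧ WithLp.toLp 2 (x, t) ∈ frontier E ∧ ∀ z ∈ Ioo (-R) R,
      (WithLp.toLp 2 (x, z) ∈ frontier E ↔ z = t) ∧ (WithLp.toLp 2 (x, z) ∈ E ↔ z ≤ t) := by
  have hxR : ‖x‖ < R := by linarith
  have hbot := mem_of_isSphereNormal_zero h₀ hxR
  have htop := notMem_of_isSphereNormal_zero h₀ hxR
  obtain ⟨t, ht, htE⟩ := exists_mem_frontier_of_vertical hbot htop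
  rw [uIcc_of_le (by linarith)] at ht
  have ht' : |t| ≤ R := abs_le.2 ht
  have hlt := abs_snd_le_of_mem_frontier hR hE h₀ htE hx ht'
  have huniq : ∀ z, |z| ≤ R → WithLp.toLp 2 (x, z) ∈ frontier E → z = t := fun z hz hzE =>
    eq_of_mem_frontier_of_vertical hR hE hN h₀ hx hz ht' hzE htE
  refine ⟨t, hlt, htE, fun z hz => ⟨⟨huniq z (abs_le.2 ⟨hz.1.le, hz.2.le⟩), ?_⟩, ?_, ?_⟩⟩
  · rintro rfl
    exact htE
  · intro hzE
    by_contra! htz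
    obtain ⟨w, hw, hwE⟩ := exists_mem_frontier_of_vertical hzE htop
    rw [uIcc_of_le hz.2.le] at hw
    have := huniq w (abs_le.2 ⟨by linarith [hz.1, hw.1], hw.2⟩) hwE
    linarith [hw.1]
  · intro hzt
    by_contra hzE
    obtain ⟨w, hw, hwE⟩ := exists_mem_frontier_of_vertical hbot hzE
    rw [uIcc_of_le hz.1.le] at hw
    have := huniq w (abs_le.2 ⟨hw.1, hw.2.trans hz.2.le⟩) hwE
    have hzw : z = t := le_antisymm hzt (this ▸ hw.2)
    exact hzE (hzw ▸ hE.frontier_subset htE)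

theorem exists_graph (hR : 0 < R) (hE : IsClosed E)
    (hN : ∀ p ∈ frontier E, ∃ ν, IsSphereNormal E R p ν) (h₀E : 0 ∈ frontier E)
    (h₀ : IsSphereNormal E R 0 (WithLp.toLp 2 (0, 1))) :
    ∃ (f : F → ℝ) (G : F → F),
      (∀ x, ‖x‖ < R / 2 → |f x| ≤ R / 4 ∧ ∀ z ∈ Ioo (-R) R,
        (WithLp.toLp 2 (x, z) ∈ frontier E ↔ z = f x) ∧ (WithLp.toLp 2 (x, z) ∈ E ↔ z ≤ f x)) ∧
      f 0 = 0 ∧ G 0 = 0 ∧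
      (∀ x, ‖x‖ < R / 2 → HasFDerivAt f (innerSL ℝ (G x)) x ∧ ‖G x‖ ≤ 2) ∧
      ∀ x y, ‖x‖ < R / 2 → ‖y‖ < R / 2 → ‖G x - G y‖ ≤ 12 / R * ‖x - y‖ := by
  have hex : ∀ x : F, ∃ t, ‖x‖ < R / 2 → |t| ≤ R / 4 ∧ WithLp.toLp 2 (x, t) ∈ frontier E ∧
      ∀ z ∈ Ioo (-R) R,
        (WithLp.toLp 2 (x, z) ∈ frontier E ↔ z = t) ∧ (WithLp.toLp 2 (x, z) ∈ E ↔ z ≤ t) := by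
    intro x
    by_cases hx : ‖x‖ < R / 2
    · obtain ⟨t, ht⟩ := exists_height hR hE hN h₀ hx
      exact ⟨t, fun _ => ht⟩
    · exact ⟨0, fun h => absurd h hx⟩
  choose f hf using hex
  have hfR : ∀ x, ‖x‖ < R / 2 → |f x| ≤ R := fun x hx => by linarith [(hf x hx).1]
  have hνex : ∀ x : F, ∃ ν, ‖x‖ < R / 2 → IsSphereNormal E R (WithLp.toLp 2 (x, f x)) ν := by
    intro x
    by_cases hx : ‖x‖ < R / 2
    · obtain ⟨ν, hν⟩ := hN _ (hf x hx).2.1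
      exact ⟨ν, fun _ => hν⟩
    · exact ⟨0, fun h => absurd h hx⟩
  choose ν hν using hνex
  have h0 : ‖(0 : F)‖ < R / 2 := by rw [norm_zero]; linarith
  have hf0 : f 0 = 0 := ((((hf 0 h0).2.2 0 ⟨by linarith, hR⟩).1).1 h₀E).symm
  have hb : ∀ x, ‖x‖ < R / 2 → 27 / 32 ≤ (ν x).snd := fun x hx =>
    le_snd_of_isSphereNormal hR hE h₀ (hf x hx).2.1 hx (hfR x hx) (hν x hx)
  have hest := fun x y (hx : ‖x‖ < R / 2) (hy : ‖y‖ < R / 2) =>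
    graph_estimates hR hE h₀ (hf x hx).2.1 hx (hfR x hx) (hν x hx) (hf y hy).2.1 hy (hfR y hy)
  simp only [WithLp.toLp_fst, WithLp.toLp_snd] at hest
  refine ⟨f, fun x => -((ν x).snd⁻¹ • (ν x).fst), fun x hx => ⟨(hf x hx).1, (hf x hx).2.2⟩, hf0,
    ?_, fun x hx => ⟨?_, ?_⟩, fun x y hx hy => ?_⟩
  · have h := (hν 0 h0).norm_sub_le hR h₀
    rw [hf0, show WithLp.toLp 2 ((0 : F), (0 : ℝ)) = 0 from rfl, sub_zero, norm_zero, zero_div]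
      at h
    have hν0 := sub_eq_zero.1 (norm_eq_zero.1 (le_antisymm h (norm_nonneg _)))
    simp [hν0]
  · have hbp : (ν x).snd ≠ 0 := by linarith [hb x hx]
    have hO : (fun y => f y - f x - innerSL ℝ (-((ν x).snd⁻¹ • (ν x).fst)) (y - x))
        =O[𝓝 x] fun y => ‖y - x‖ ^ 2 := by
      refine Asymptotics.IsBigO.of_bound (6 / 5 * (5 / R)) ?_
      filter_upwards [(continuous_norm.isOpen_preimage _ isOpen_Iio).mem_nhds
        (show x ∈ norm ⁻¹' Iio (R / 2) from hx)] with y hy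
      have he := (hest x y hx hy).2
      have hrw : f y - f x - innerSL ℝ (-((ν x).snd⁻¹ • (ν x).fst)) (y - x) = (ν x).snd⁻¹ *
          (inner ℝ (ν x).fst (y - x) + (ν x).snd * (f y - f x)) := by
        rw [innerSL_apply_apply, inner_neg_left, real_inner_smul_left]
        field_simp
        ring
      rw [hrw, Real.norm_eq_abs, abs_mul, norm_pow, norm_norm, mul_assoc]
      exact mul_le_mul (abs_inv_le_of_le (hb x hx)) he (abs_nonneg _) (by norm_num)
    have h := (hO.hasFDerivAt one_lt_two).add
      ((innerSL ℝ (-((ν x).snd⁻¹ • (ν x).fst))).hasFDerivAt (x := x))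
    rw [zero_add] at h
    refine (h.add_const (f x - innerSL ℝ (-((ν x).snd⁻¹ • (ν x).fst)) x)).congr_of_eventuallyEq
      (Eventually.of_forall fun y => ?_)
    simp only [Pi.add_apply, map_sub]
    ring
  · rw [norm_neg, norm_smul, Real.norm_eq_abs]
    have h1 : ‖(ν x).fst‖ ≤ 1 := (WithLp.norm_fst_le _ _).trans (hν x hx).1.le
    nlinarith [abs_inv_le_of_le (hb x hx), abs_nonneg (ν x).snd⁻¹, norm_nonneg (ν x).fst]
  · have hG := norm_inv_smul_sub_le (hν x hx).1 (hb x hx) (hb y hy)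
    have hL := (hν x hx).norm_sub_le hR (hν y hy)
    have hd : ‖WithLp.toLp 2 (x, f x) - WithLp.toLp 2 (y, f y)‖ ≤ 4 * ‖x - y‖ := by
      refine le_of_sq_le_sq ?_ (by positivity)
      have h3 := pow_le_pow_left₀ (abs_nonneg _) (hest y x hy hx).1 2
      rw [WithLp.prod_norm_sq_eq_of_L2]
      simp only [WithLp.sub_fst, WithLp.sub_snd, WithLp.toLp_fst, WithLp.toLp_snd,
        Real.norm_eq_abs]
      nlinarith [sq_nonneg ‖x - y‖]
    rw [neg_sub_neg, norm_sub_rev]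
    calc _ ≤ 3 * ‖ν x - ν y‖ := hG
      _ ≤ 3 * ((4 * ‖x - y‖) / R) := by
        gcongr
        exact hL.trans (by gcongr)
      _ = 12 / R * ‖x - y‖ := by ring

end Graph

theorem norm_emb_sq {n : ℕ} (hn : 0 < n) (x : En (n - 1)) (z : ℝ) :
    ‖emb n x z‖ ^ 2 = ‖x‖ ^ 2 + z ^ 2 := by
  cases n with
  | zero => exact absurd hn (lt_irrefl 0)
  | succ m =>
    rw [EuclideanSpace.norm_sq_eq, EuclideanSpace.norm_sq_eq, Fin.sum_univ_castSucc]
    simp [emb]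

/-- The map `(x, z) ↦ emb n x z` as a linear isometry equivalence. -/
def embIsometry (n : ℕ) (hn : 0 < n) : WithLp 2 (En (n - 1) × ℝ) ≃ₗᵢ[ℝ] En n :=
  LinearIsometry.toLinearIsometryEquiv
    { toFun := fun p => emb n p.fst p.snd
      map_add' := fun p q => by
        ext i
        by_cases h : (i : ℕ) < n - 1 <;> simp [emb, h]
      map_smul' := fun c p => by
        ext i
        by_cases h : (i : ℕ) < n - 1 <;> simp [emb, h]
      norm_map' := fun p => by
        refine (sq_eq_sq₀ (norm_nonneg _) (norm_nonneg _)).1 ?_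
        rw [WithLp.prod_norm_sq_eq_of_L2, Real.norm_eq_abs, sq_abs]
        exact norm_emb_sq hn p.fst p.snd }
    (by
      rw [(WithLp.linearEquiv 2 ℝ (En (n - 1) × ℝ)).finrank_eq, Module.finrank_prod]
      simp only [finrank_euclideanSpace_fin, Module.finrank_self]
      omega)

theorem isSphereNormal_preimage_of_admissible {V W : Type*} [NormedAddCommGroup V]
    [InnerProductSpace ℝ V] [PseudoMetricSpace W] (G : V ≃ᵢ W) {E : Set W} {R : ℝ} (hR : 0 < R)
    {p p' p'' : W} (h' : dist p p' = R) (h'' : dist p p'' = R) (hin : ball p' R ⊆ E)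
    (hout : ball p'' R ∩ E = ∅) :
    IsSphereNormal (G ⁻¹' E) R (G.symm p) (R⁻¹ • (G.symm p'' - G.symm p)) := by
  refine (isSphereNormal_of_admissible (p' := G.symm p') hR ?_ ?_ ?_ ?_).2
  · rwa [G.symm.isometry.dist_eq]
  · rwa [G.symm.isometry.dist_eq]
  · rw [← G.preimage_ball]
    exact preimage_mono hin
  · rw [← G.preimage_ball, ← preimage_inter, hout, preimage_empty]

theorem boundary_is_C11_graph (n : ℕ) (hn : 2 ≤ n) (R : ℝ) (hR : 0 < R) :
    ∃ ρ > (0:ℝ), ∃ c > (0:ℝ), ∀ E ∈ UR n R, ∀ p₀ ∈ frontier E, ∀ p₀' p₀'' : En n,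
      dist p₀ p₀' = R → dist p₀ p₀'' = R → ball p₀' R ⊆ E → ball p₀'' R ∩ E = ∅ →
      ∀ g : En n ≃ᵢ En n, g 0 = p₀ → g (emb n 0 1) - g 0 = (2 * R)⁻¹ • (p₀'' - p₀') →
      ∃ f : En (n - 1) → ℝ,
        frontier E ∩ (g '' {q | ∃ x : En (n - 1), ‖x‖ < ρ ∧ ∃ z ∈ Ioo (-R) R, q = emb n x z})
          = g '' {q | ∃ x : En (n - 1), ‖x‖ < ρ ∧ q = emb n x (f x)} ∧
        E ∩ (g '' {q | ∃ x : En (n - 1), ‖x‖ < ρ ∧ ∃ z ∈ Ioo (-R) R, q = emb n x z})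
          = g '' {q | ∃ x : En (n - 1), ‖x‖ < ρ ∧ ∃ z ∈ Ioo (-R) R, z ≤ f x ∧ q = emb n x z} ∧
        f 0 = 0 ∧
        (∀ x ∈ ball (0 : En (n - 1)) ρ, DifferentiableAt ℝ f x) ∧
        fderiv ℝ f 0 = 0 ∧
        (∀ x ∈ ball (0 : En (n - 1)) ρ, |f x| ≤ c ∧ ‖fderiv ℝ f x‖ ≤ c) ∧
        LipschitzOnWith (Real.toNNReal c) (fun x => fderiv ℝ f x)
          (ball (0 : En (n - 1)) ρ) := by
  refine ⟨R / 2, by positivity, R + 2 + 12 / R, by positivity, ?_⟩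
  rintro E ⟨hE, -, hS⟩ p₀ hp₀ p₀' p₀'' h' h'' hin hout g hg0 hge
  have hn0 : 0 < n := by omega
  set G := (embIsometry n hn0).toIsometryEquiv.trans g with hG
  have hGemb : ∀ x z, G (WithLp.toLp 2 (x, z)) = g (emb n x z) := fun _ _ => rfl
  have hG0 : G 0 = p₀ := by
    rw [← hg0, hG, IsometryEquiv.trans_apply]
    exact congrArg g (map_zero (embIsometry n hn0))
  have hfr : G ⁻¹' frontier E = frontier (G ⁻¹' E) := G.toHomeomorph.preimage_frontier E
  have hN : ∀ p ∈ frontier (G ⁻¹' E), ∃ ν, IsSphereNormal (G ⁻¹' E) R p ν := by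
    intro p hp
    rw [← hfr] at hp
    obtain ⟨p', p'', hp', hp'', hpin, hpout⟩ := hS _ hp
    have := isSphereNormal_preimage_of_admissible G hR hp' hp'' hpin hpout
    rw [G.symm_apply_apply] at this
    exact ⟨_, this⟩
  have h₀ : IsSphereNormal (G ⁻¹' E) R 0 (WithLp.toLp 2 (0, 1)) := by
    have h := isSphereNormal_preimage_of_admissible G hR h' h'' hin hout
    have hopp := (isSphereNormal_of_admissible hR h' h'' hin hout).1
    have hp'' : p₀'' = G (R • WithLp.toLp 2 (0, 1)) := by
      rw [← sub_left_inj (a := G 0), ← G.toRealLinearIsometryEquiv_apply, map_smul,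
        G.toRealLinearIsometryEquiv_apply, hGemb 0 1, hG0, ← hg0, hge, hg0,
        show p₀'' - p₀' = (2 : ℝ) • (p₀'' - p₀) by rw [two_smul]; nth_rw 2 [hopp]; abel,
        smul_smul, smul_smul, show R * (2 * R)⁻¹ * 2 = 1 by field_simp, one_smul]
    rwa [← hG0, G.symm_apply_apply, hp'', G.symm_apply_apply, sub_zero,
      inv_smul_smul₀ hR.ne'] at h
  have h₀E : 0 ∈ frontier (G ⁻¹' E) := by
    rw [← hfr, mem_preimage, hG0]
    exact hp₀
  obtain ⟨f, D, hf, hf0, hD0, hD, hL⟩ :=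
    exists_graph hR (hE.preimage G.continuous) hN h₀E h₀
  have hgr : ∀ x, ‖x‖ < R / 2 → ∀ z ∈ Ioo (-R) R,
      (g (emb n x z) ∈ frontier E ↔ z = f x) ∧ (g (emb n x z) ∈ E ↔ z ≤ f x) := by
    intro x hx z hz
    rw [← hGemb, ← mem_preimage, hfr, ← mem_preimage]
    exact (hf x hx).2 z hz
  have hfI : ∀ x, ‖x‖ < R / 2 → f x ∈ Ioo (-R) R := fun x hx =>
    abs_lt.1 (by linarith [(hf x hx).1])
  have hfd : ∀ x, ‖x‖ < R / 2 → fderiv ℝ f x = innerSL ℝ (D x) := fun x hx => (hD x hx).1.fderiv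
  have hR12 : 0 < 12 / R := by positivity
  refine ⟨f, ?_, ?_, hf0, fun x hx => ?_, ?_, fun x hx => ?_, ?_⟩
  · ext p
    constructor
    · rintro ⟨hpE, _, ⟨x, hx, z, hz, rfl⟩, rfl⟩
      exact ⟨_, ⟨x, hx, by rw [← ((hgr x hx z hz).1).1 hpE]⟩, rfl⟩
    · rintro ⟨_, ⟨x, hx, rfl⟩, rfl⟩
      exact ⟨((hgr x hx _ (hfI x hx)).1).2 rfl, _, ⟨x, hx, _, hfI x hx, rfl⟩, rfl⟩
  · ext p
    constructor
    · rintro ⟨hpE, _, ⟨x, hx, z, hz, rfl⟩, rfl⟩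
      exact ⟨_, ⟨x, hx, z, hz, ((hgr x hx z hz).2).1 hpE, rfl⟩, rfl⟩
    · rintro ⟨_, ⟨x, hx, z, hz, hzf, rfl⟩, rfl⟩
      exact ⟨((hgr x hx z hz).2).2 hzf, _, ⟨x, hx, z, hz, rfl⟩, rfl⟩
  · exact (hD x (mem_ball_zero_iff.1 hx)).1.differentiableAt
  · rw [hfd 0 (by rw [norm_zero]; positivity), hD0, map_zero]
  · rw [mem_ball_zero_iff] at hx
    rw [hfd x hx, innerSL_apply_norm]
    exact ⟨by linarith [(hf x hx).1], by linarith [(hD x hx).2]⟩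
  · refine LipschitzOnWith.of_dist_le_mul fun x hx y hy => ?_
    rw [mem_ball_zero_iff] at hx hy
    rw [hfd x hx, hfd y hy, dist_eq_norm, ← map_sub, innerSL_apply_norm, dist_eq_norm,
      Real.coe_toNNReal _ (by positivity)]
    exact (hL x y hx hy).trans (by gcongr; linarith)
end
end

section
/- Let n ≥ 2, let Ω ⊆ ℝ^{n−1} be an open bounded set, and let φ : ℝⁿ × ℝ^{n−1} → [0, +∞) be continuous and convex in its last n−1 variables. Let f_h, f : Ω → ℝ be C^{1,1} functions such that sup_h (sup|f_h| + sup|∇f_h| + Lip(∇f_h)) < ∞, f_h → f and ∇f_h → ∇f uniformly on Ω, and ∂_i∂_j f_h → ∂_i∂_j f weak* in L^∞(Ω) for all i, j (i.e., ∫_Ω ∂_i∂_j f_h ψ dx → ∫_Ω ∂_i∂_j f ψ dx for every ψ ∈ L¹(Ω)). Then ∫_Ω φ((x, f(x)), K_1^f(x), …, K_{n−1}^f(x)) √(1 + |∇f(x)|²) dx ≤ liminf_{h→∞} ∫_Ω φ((x, f_h(x)), K_1^{f_h}(x), …, K_{n−1}^{f_h}(x)) √(1 + |∇f_h(x)|²)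 dx. (By the area formula these integrals coincide with the integrals of φ(q, K_1, …, K_{n−1}) over the graphs of f and f_h with respect to H^{n−1}.) -/
open Set Metric MeasureTheory Filter Topology ENNReal NNReal

noncomputable section

def pd (n : ℕ) (f : En (n - 1) → ℝ) (i : Fin (n - 1)) (x : En (n - 1)) : ℝ :=
  fderiv ℝ f x (EuclideanSpace.single i 1)

def pd2 (n : ℕ) (f : En (n - 1) → ℝ) (i j : Fin (n - 1)) (x : En (n - 1)) : ℝ :=
  fderiv ℝ (pd n f i) x (EuclideanSpace.single j 1)

def Gmat (n : ℕ) (f : En (n - 1) → ℝ) (x : En (n - 1)) : Matrix (Fin (n - 1)) (Fin (n - 1)) ℝ :=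
  fun i j => (if i = j then 1 else 0) + pd n f i x * pd n f j x

def Bmat (n : ℕ) (f : En (n - 1) → ℝ) (x : En (n - 1)) : Matrix (Fin (n - 1)) (Fin (n - 1)) ℝ :=
  fun i j => pd2 n f i j x / Real.sqrt (1 + ‖fderiv ℝ f x‖ ^ 2)

/-- The `p`-th elementary symmetric curvature of the graph of `f` at `(x, f x)`:
`binom(n-1,p)⁻¹ (−1)^p` times the degree-`(n-1-p)` coefficient of the characteristic
polynomial of `G⁻¹B`. -/
def Kp (n : ℕ) (f : En (n - 1) → ℝ) (p : ℕ) (x : En (n - 1)) : ℝ :=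
  ((n - 1).choose p : ℝ)⁻¹ *
    ((-1 : ℝ) ^ p * (((Gmat n f x)⁻¹ * Bmat n f x).charpoly.coeff (n - 1 - p)))

def Kvec (n : ℕ) (f : En (n - 1) → ℝ) (x : En (n - 1)) : En (n - 1) :=
  (WithLp.equiv 2 (Fin (n - 1) → ℝ)).symm (fun i => Kp n f ((i : ℕ) + 1) x)

/-- The Jacobian matrix, with rows the gradients of the functions `u i`. -/
def jacobian {m : ℕ} (u : Fin m → En m → ℝ) (x : En m) : Matrix (Fin m) (Fin m) ℝ :=
  Matrix.of fun i j => fderiv ℝ (u i) x (EuclideanSpace.single j 1)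

/-- The coefficients of a polynomial of degree at most `d` are fixed linear combinations of its
values at `d + 1` distinct nodes. -/
lemma exists_coeff_eq_sum_eval (d k : ℕ) (t : Fin (d + 1) → ℝ) (ht : Function.Injective t) :
    ∃ w : Fin (d + 1) → ℝ, ∀ P : Polynomial ℝ, P.natDegree ≤ d →
      P.coeff k = ∑ i, w i * P.eval (t i) := by
  refine ⟨fun i => (Lagrange.basis Finset.univ t i).coeff k, fun P hP => ?_⟩
  have h := Lagrange.eq_interpolate (s := Finset.univ) (v := t) (f := P) ht.injOn (by
    rw [Finset.card_univ, Fintype.card_fin]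
    exact lt_of_le_of_lt (Polynomial.degree_le_of_natDegree_le hP)
      (by exact_mod_cast Nat.lt_succ_self d))
  conv_lhs => rw [h]
  rw [Lagrange.interpolate_apply, Polynomial.finsetSum_coeff]
  refine Finset.sum_congr rfl fun i _ => ?_
  rw [Polynomial.coeff_C_mul, mul_comm]

lemma det_eq_det_of_single {m : ℕ} (L : En m →L[ℝ] En m) :
    L.det = (Matrix.of fun i j => (L (EuclideanSpace.single j 1)) i).det := by
  rw [ContinuousLinearMap.det, ← LinearMap.det_toMatrix (EuclideanSpace.basisFun (Fin m) ℝ).toBasis]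
  congr 1

/-- A small compactly supported Lipschitz perturbation of the identity preserves the volume of a
ball containing the support of the perturbation. -/
lemma exists_integral_det_one_add_smul {m : ℕ} (hm : 1 ≤ m) {V : En m → En m} {K : ℝ≥0}
    (hV : LipschitzWith K V) {R : ℝ} (hR : ∀ x, x ∉ closedBall (0 : En m) R → V x = 0) :
    ∃ t₀ > 0, ∀ t : ℝ, |t| < t₀ →
      ∫ x in closedBall (0 : En m) R, (ContinuousLinearMap.id ℝ (En m) + t • fderiv ℝ V x).det
        = volume.real (closedBall (0 : En m) R) := by
  have : Nonempty (Fin m) := ⟨⟨0, hm⟩⟩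
  have : Nontrivial (En m) := inferInstance
  obtain ⟨δ, hδ, hdet⟩ : ∃ δ > 0, ∀ A : En m →L[ℝ] En m,
      dist A (ContinuousLinearMap.id ℝ (En m)) < δ → 0 < A.det := by
    have h : ∀ᶠ A : En m →L[ℝ] En m in 𝓝 (ContinuousLinearMap.id ℝ (En m)), 0 < A.det := by
      apply (ContinuousLinearMap.continuous_det (E := En m) (𝕜 := ℝ)).continuousAt.eventually
      apply lt_mem_nhds
      simp [ContinuousLinearMap.det]
    exact Metric.eventually_nhds_iff.1 h
  obtain ⟨η, hη, hη0⟩ := ((addHaar_image_le_mul_of_det_lt (volume : Measure (En m))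
    (ContinuousLinearMap.id ℝ (En m)) (m := 2)
    (by simp [ContinuousLinearMap.det])).and self_mem_nhdsWithin).exists
  have hη0' : (0 : ℝ) < η := hη0
  refine ⟨min 1 (min δ η) / (K + 1), by positivity, fun t ht => ?_⟩
  have htK : |t| * K < min 1 (min δ η) := by
    rw [lt_div_iff₀ (by positivity)] at ht
    nlinarith [abs_nonneg t]
  have htK1 : |t| * K < 1 := htK.trans_le (min_le_left _ _)
  have htKδ : |t| * K < δ := htK.trans_le ((min_le_right _ _).trans (min_le_left _ _))
  have htKη : |t| * K < η := htK.trans_le ((min_le_right _ _).trans (min_le_right _ _))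
  set F : En m → En m := fun x => x + t • V x with hF
  have happ : ∀ c : ℝ≥0, |t| * K ≤ c →
      ApproximatesLinearOn F (ContinuousLinearMap.id ℝ (En m)) univ c := by
    intro c hc x _ y _
    have : F x - F y - (ContinuousLinearMap.id ℝ (En m)) (x - y) = t • (V x - V y) := by
      simp only [hF, ContinuousLinearMap.id_apply, smul_sub]; abel
    rw [this, norm_smul, Real.norm_eq_abs]
    have h1 := hV.norm_sub_le x y
    calc |t| * ‖V x - V y‖ ≤ |t| * (K * ‖x - y‖) := by gcongr
      _ = |t| * K * ‖x - y‖ := by ring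
      _ ≤ _ := by gcongr
  set c : ℝ≥0 := ⟨|t| * K, by positivity⟩ with hc
  have happ' : ApproximatesLinearOn F
      ((ContinuousLinearEquiv.refl ℝ (En m) : En m ≃L[ℝ] En m) : En m →L[ℝ] En m) univ c :=
    happ c le_rfl
  have hc1 : c < ‖((ContinuousLinearEquiv.refl ℝ (En m)).symm : En m →L[ℝ] En m)‖₊⁻¹ := by
    have : ‖((ContinuousLinearEquiv.refl ℝ (En m)).symm : En m →L[ℝ] En m)‖₊ = 1 := by
      have : ((ContinuousLinearEquiv.refl ℝ (En m)).symm : En m →L[ℝ] En m)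
        = ContinuousLinearMap.id ℝ (En m) := rfl
      rw [this]
      exact NNReal.eq ContinuousLinearMap.norm_id
    rw [this, inv_one]
    exact_mod_cast htK1
  have hinj : Function.Injective F := injOn_univ.1 (happ'.injOn (Or.inr hc1))
  have hsurj : Function.Surjective F := happ'.surjective (Or.inr hc1)
  set B := closedBall (0 : En m) R with hB
  have hFB : F '' B = B := by
    have h1 : F '' Bᶜ = Bᶜ := by
      have : EqOn F id Bᶜ := fun x hx => by simp [hF, hR x hx]
      rw [this.image_eq, image_id]
    have h2 := image_compl_eq (s := B) ⟨hinj, hsurj⟩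
    rw [h1] at h2
    exact (compl_injective h2).symm
  set S := {x | DifferentiableAt ℝ V x} with hS
  have hSm : MeasurableSet S := measurableSet_of_differentiableAt ℝ V
  have hSae : ∀ᵐ x, x ∈ S := hV.ae_differentiableAt
  have hS0 : volume Sᶜ = 0 := hSae
  have hBS : (B ∩ S : Set (En m)) =ᵐ[volume] B := by
    rw [eventuallyEq_set]
    filter_upwards [hSae] with x hx
    exact and_iff_left hx
  have hFBS : (F '' (B ∩ S) : Set (En m)) =ᵐ[volume] B := by
    refine Filter.EventuallyLE.antisymm
      (LE.le.eventuallyLE ((image_mono inter_subset_left).trans hFB.le)) ?_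
    rw [ae_le_set]
    refine measure_mono_null (t := F '' Sᶜ) ?_ ?_
    · rintro y ⟨hy, hy'⟩
      rw [← hFB] at hy
      obtain ⟨x, hx, rfl⟩ := hy
      exact ⟨x, fun hxS => hy' ⟨x, ⟨hx, hxS⟩, rfl⟩, rfl⟩
    · refine le_antisymm ?_ zero_le
      refine (hη Sᶜ F ((happ η htKη.le).mono_set (subset_univ _))).trans ?_
      simp [hS0]
  have hder : ∀ x ∈ B ∩ S, HasFDerivWithinAt F
      (ContinuousLinearMap.id ℝ (En m) + t • fderiv ℝ V x) (B ∩ S) x := fun x hx =>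
    ((hasFDerivAt_id x).add (hx.2.hasFDerivAt.const_smul t)).hasFDerivWithinAt
  have hcov := integral_image_eq_integral_abs_det_fderiv_smul volume
    (measurableSet_closedBall.inter hSm) hder hinj.injOn (fun _ => (1 : ℝ))
  rw [setIntegral_congr_set hFBS, setIntegral_congr_set hBS] at hcov
  have hpos : ∀ x, 0 < (ContinuousLinearMap.id ℝ (En m) + t • fderiv ℝ V x).det := fun x => by
    apply hdet
    rw [dist_eq_norm, add_sub_cancel_left, norm_smul, Real.norm_eq_abs]
    refine lt_of_le_of_lt ?_ htKδ
    gcongr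
    exact norm_fderiv_le_of_lipschitz ℝ hV
  simp only [abs_of_pos (hpos _), smul_eq_mul, mul_one] at hcov
  rw [← hcov]
  simp

lemma det_fderiv_toLp_eq {m : ℕ} {u : Fin m → En m → ℝ} {x : En m}
    (hu : DifferentiableAt ℝ (fun y => (WithLp.toLp 2 (fun i => u i y) : En m)) x) :
    (fderiv ℝ (fun y => (WithLp.toLp 2 (fun i => u i y) : En m)) x).det = (jacobian u x).det := by
  rw [det_eq_det_of_single]
  congr 1
  ext i j
  have h := ((EuclideanSpace.proj (𝕜 := ℝ) i : En m →L[ℝ] ℝ).hasFDerivAt.comp x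
    hu.hasFDerivAt).fderiv
  have h' : (⇑(EuclideanSpace.proj (𝕜 := ℝ) i : En m →L[ℝ] ℝ) ∘
      fun y => (WithLp.toLp 2 (fun i => u i y) : En m)) = u i := rfl
  rw [h'] at h
  simp [jacobian, h]

lemma integral_det_jacobian_eq_zero_of_ball {m : ℕ} (hm : 1 ≤ m) {u : Fin m → En m → ℝ}
    {K : ℝ≥0} (hu : ∀ i, LipschitzWith K (u i)) {R : ℝ}
    (hR : ∀ i, ∀ x ∉ closedBall (0 : En m) R, u i x = 0) :
    ∫ x, (jacobian u x).det = 0 := by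
  have : Nonempty (Fin m) := ⟨⟨0, hm⟩⟩
  set V : En m → En m := fun y => WithLp.toLp 2 (fun i => u i y) with hVdef
  obtain ⟨K', hV⟩ : ∃ K', LipschitzWith K' V :=
    ⟨_, (PiLp.lipschitzWith_toLp 2 (fun _ : Fin m => ℝ)).comp 
      (fun x y => edist_pi_le_iff.2 fun i => hu i x y : LipschitzWith K fun y i => u i y)⟩
  have hdiff : ∀ᵐ x, DifferentiableAt ℝ V x := hV.ae_differentiableAt
  set B := closedBall (0 : En m) R with hB
  obtain ⟨t₀, ht₀, hint⟩ := exists_integral_det_one_add_smul hm hV (R := R)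
    (fun x hx => by ext i; simp [hVdef, hR i x hx])
  set t : Fin (m + 1) → ℝ := fun i => t₀ * ((i : ℝ) / (m + 1)) with ht
  have htinj : Function.Injective t := by
    intro i j hij
    simp only [ht] at hij
    have : (m : ℝ) + 1 ≠ 0 := by positivity
    field_simp at hij
    exact Fin.ext (by exact_mod_cast hij)
  have htlt : ∀ i, |t i| < t₀ := by
    intro i
    have hi : (i : ℝ) < m + 1 := by exact_mod_cast i.2
    rw [abs_of_nonneg (by positivity)]
    calc t i < t₀ * 1 := by
          apply mul_lt_mul_of_pos_left _ ht₀
          rw [div_lt_one (by positivity)]; exact hi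
      _ = t₀ := mul_one _
  obtain ⟨w, hw⟩ := exists_coeff_eq_sum_eval m m t htinj
  have hw0 : ∑ i, w i = 0 := by
    have := hw 1 (by simp)
    rw [Polynomial.coeff_one, if_neg (by omega)] at this
    simpa using this.symm
  have hdet : ∀ L : En m →L[ℝ] En m,
      L.det = ∑ i, w i * (ContinuousLinearMap.id ℝ (En m) + t i • L).det := by
    intro L
    set A : Matrix (Fin m) (Fin m) ℝ := Matrix.of fun i j => (L (EuclideanSpace.single j 1)) i
      with hA
    have h := hw (((Polynomial.X : Polynomial ℝ) • A.map Polynomial.C +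
      (1 : Matrix (Fin m) (Fin m) ℝ).map Polynomial.C).det)
      (by simpa using Polynomial.natDegree_det_X_add_C_le A 1)
    have h2 := Polynomial.coeff_det_X_add_C_card A 1
    rw [Fintype.card_fin] at h2
    rw [h2] at h
    rw [det_eq_det_of_single, h]
    refine Finset.sum_congr rfl fun i _ => ?_
    congr 1
    rw [det_eq_det_of_single, ← Polynomial.coe_evalRingHom, RingHom.map_det]
    congr 1
    ext k l
    simp [hA, Matrix.one_apply, apply_ite, add_comm, eq_comm]
    ring
  have hmeas : ∀ s : ℝ, IntegrableOn
      (fun x => (ContinuousLinearMap.id ℝ (En m) + s • fderiv ℝ V x).det) B := by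
    intro s
    obtain ⟨C, hC⟩ := (isCompact_closedBall (0 : En m →L[ℝ] En m)
      (‖ContinuousLinearMap.id ℝ (En m)‖ + |s| * K')).exists_bound_of_continuousOn
      (f := fun L => L.det) ContinuousLinearMap.continuous_det.continuousOn
    refine Measure.integrableOn_of_bounded (M := C) measure_closedBall_lt_top.ne ?_ ?_
    · exact (ContinuousLinearMap.continuous_det.measurable.comp
        (measurable_const.add ((measurable_fderiv ℝ V).const_smul s))).aestronglyMeasurable
    · refine Eventually.of_forall fun x => hC _ ?_
      rw [mem_closedBall_zero_iff]
      refine (norm_add_le _ _).trans ?_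
      rw [norm_smul, Real.norm_eq_abs]
      gcongr
      exact norm_fderiv_le_of_lipschitz ℝ hV
  have h0 : ∀ x ∉ B, (jacobian u x).det = 0 := by
    intro x hx
    have : jacobian u x = 0 := by
      ext i j
      have : u i =ᶠ[𝓝 x] fun _ => 0 := by
        filter_upwards [isClosed_closedBall.isOpen_compl.mem_nhds hx] with y hy
        exact hR i y hy
      simp [jacobian, this.fderiv_eq]
    rw [this, Matrix.det_zero]
  rw [← setIntegral_eq_integral_of_forall_compl_eq_zero h0]
  have h1 : ∫ x in B, (jacobian u x).det = ∫ x in B, ∑ i, w i *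
      (ContinuousLinearMap.id ℝ (En m) + t i • fderiv ℝ V x).det := by
    refine integral_congr_ae (ae_restrict_of_ae ?_)
    filter_upwards [hdiff] with x hx
    rw [← hdet, det_fderiv_toLp_eq hx]
  rw [h1, integral_finsetSum _ fun i _ => (hmeas _).const_mul _]
  simp_rw [integral_const_mul]
  rw [Finset.sum_congr rfl fun i _ => by rw [hint _ (htlt i)], ← Finset.sum_mul, hw0, zero_mul]

lemma exists_lipschitzWith_mul {X : Type*} [PseudoMetricSpace X] {ψ u : X → ℝ} {K L : ℝ≥0}
    (hψ : LipschitzWith K ψ) (hc : HasCompactSupport ψ) (hu : LipschitzWith L u) :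
    ∃ C, LipschitzWith C (fun x => ψ x * u x) := by
  obtain ⟨M, hM⟩ := hc.isCompact.exists_bound_of_continuousOn hu.continuous.continuousOn
  obtain ⟨N, hN⟩ := hc.exists_bound_of_continuous hψ.continuous
  simp only [Real.norm_eq_abs] at hM hN
  have key : ∀ x y, x ∈ tsupport ψ →
      dist (ψ x * u x) (ψ y * u y) ≤ (|M| * K + |N| * L) * dist x y := by
    intro x y hx
    have h1 := hψ.dist_le_mul x y
    have h2 := hu.dist_le_mul x y
    rw [Real.dist_eq] at h1 h2 ⊢
    have h3 : ψ x * u x - ψ y * u y = u x * (ψ x - ψ y) + ψ y * (u x - u y) := by ring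
    rw [h3]
    refine (abs_add_le _ _).trans ?_
    rw [abs_mul, abs_mul, add_mul, mul_assoc, mul_assoc]
    exact add_le_add
      (mul_le_mul ((hM x hx).trans (le_abs_self _)) h1 (abs_nonneg _) (abs_nonneg _))
      (mul_le_mul ((hN y).trans (le_abs_self _)) h2 (abs_nonneg _) (abs_nonneg _))
  refine ⟨⟨|M| * K + |N| * L, by positivity⟩, LipschitzWith.of_dist_le_mul fun x y => ?_⟩
  by_cases hx : x ∈ tsupport ψ
  · exact key x y hx
  · by_cases hy : y ∈ tsupport ψ
    · rw [dist_comm, dist_comm x]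
      exact key y x hy
    · rw [image_eq_zero_of_notMem_tsupport hx, image_eq_zero_of_notMem_tsupport hy]
      simp only [zero_mul, dist_self]
      exact mul_nonneg (NNReal.coe_nonneg _) dist_nonneg

lemma jacobian_update {m : ℕ} (u : Fin m → En m → ℝ) (i : Fin m) (g : En m → ℝ) (x : En m) :
    jacobian (Function.update u i g) x =
      (jacobian u x).updateRow i (fun j => fderiv ℝ g x (EuclideanSpace.single j 1)) := by
  ext k j
  by_cases h : k = i
  · subst h; simp [jacobian]
  · simp [jacobian, h]

lemma det_jacobian_eq_zero_of_notMem_tsupport {m : ℕ} {u : Fin m → En m → ℝ} {i : Fin m} {x : En m}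
    (hx : x ∉ tsupport (u i)) : (jacobian u x).det = 0 := by
  refine Matrix.det_eq_zero_of_row_eq_zero i fun j => ?_
  simp [jacobian, (notMem_tsupport_iff_eventuallyEq.1 hx).fderiv_eq]

lemma abs_det_jacobian_le {m : ℕ} {u : Fin m → En m → ℝ} {K : ℝ≥0}
    (hu : ∀ i, LipschitzWith K (u i)) (x : En m) :
    |(jacobian u x).det| ≤ m.factorial * (K : ℝ) ^ m := by
  have := Matrix.det_le (A := jacobian u x) (abv := AbsoluteValue.abs) (x := (K : ℝ)) fun i j => by
    refine ((fderiv ℝ (u i) x).le_opNorm _).trans ?_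
    simpa using norm_fderiv_le_of_lipschitz ℝ (hu i)
  simpa using this

lemma measurable_det_of_entries {X : Type*} [MeasurableSpace X] {m : ℕ}
    {A : X → Matrix (Fin m) (Fin m) ℝ} (hA : ∀ i j, Measurable fun x => A x i j) :
    Measurable fun x => (A x).det := by
  simp only [Matrix.det_apply']
  fun_prop

lemma measurable_det_jacobian {m : ℕ} (u : Fin m → En m → ℝ) :
    Measurable fun x => (jacobian u x).det :=
  measurable_det_of_entries fun _ _ => measurable_fderiv_apply_const ℝ _ _

lemma exists_uniform_lipschitzWith {m : ℕ} {u : Fin m → En m → ℝ}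
    (hu : ∀ i, ∃ K, LipschitzWith K (u i)) : ∃ K, ∀ i, LipschitzWith K (u i) := by
  choose K hK using hu
  exact ⟨∑ i, K i, fun i => (hK i).weaken (Finset.single_le_sum (fun _ _ => zero_le)
    (Finset.mem_univ i))⟩

/-- The Jacobian determinant of Lipschitz functions is a null Lagrangian. -/
lemma integral_det_jacobian_eq_zero {m : ℕ} {u : Fin m → En m → ℝ}
    (hu : ∀ i, ∃ K, LipschitzWith K (u i)) {i₀ : Fin m} (hc : HasCompactSupport (u i₀)) :
    ∫ x, (jacobian u x).det = 0 := by
  obtain ⟨R, hR0, hR⟩ := hc.isCompact.isBounded.subset_closedBall_lt 0 (0 : En m)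
  let χ : ContDiffBump (0 : En m) := ⟨R + 1, R + 2, by linarith, by linarith⟩
  have hχc : HasCompactSupport χ := χ.hasCompactSupport
  obtain ⟨L, hχL⟩ : ∃ L, LipschitzWith L χ :=
    ContDiff.lipschitzWith_of_hasCompactSupport hχc (χ.contDiff (n := 1)) (by simp)
  have hv : ∀ i, ∃ K, LipschitzWith K (fun x => χ x * u i x) := fun i => by
    obtain ⟨K, hK⟩ := hu i
    exact exists_lipschitzWith_mul hχL hχc hK
  obtain ⟨K, hK⟩ := exists_uniform_lipschitzWith hv
  rw [← integral_det_jacobian_eq_zero_of_ball (Nat.one_le_of_lt i₀.2) hK (R := R + 2)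
    fun i x hx => ?_]
  · refine integral_congr_ae (Eventually.of_forall fun x => ?_)
    by_cases hx : x ∈ tsupport (u i₀)
    · have hx' : x ∈ ball (0 : En m) (R + 1) :=
        closedBall_subset_ball (by linarith) (hR hx)
      have : jacobian (fun i x => χ x * u i x) x = jacobian u x := by
        ext i j
        have : (fun y => χ y * u i y) =ᶠ[𝓝 x] u i := by
          filter_upwards [isOpen_ball.mem_nhds hx'] with y hy
          rw [χ.one_of_mem_closedBall (ball_subset_closedBall hy), one_mul]
        simp [jacobian, this.fderiv_eq]
      simp only [this]
    · have h1 : x ∉ tsupport (fun y => χ y * u i₀ y) := fun h =>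
        hx (tsupport_mul_subset_right h)
      simp only [det_jacobian_eq_zero_of_notMem_tsupport hx,
        det_jacobian_eq_zero_of_notMem_tsupport (u := fun i x => χ x * u i x) h1]
  · have : χ x = 0 := χ.zero_of_le_dist (by
      simp only [mem_closedBall, not_le] at hx; exact hx.le)
    simp [this]

lemma integrable_of_bounded_of_isCompact {m : ℕ} {f : En m → ℝ} {S : Set (En m)} {C : ℝ}
    (hf : Measurable f) (hS : IsCompact S) (h0 : ∀ x ∉ S, f x = 0) (hC : ∀ x ∈ S, |f x| ≤ C) :
    Integrable f := by
  rw [← integrableOn_iff_integrable_of_support_subset (s := S)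
    (fun x hx => by_contra fun h => hx (h0 x h))]
  refine Measure.integrableOn_of_bounded (M := C) hS.measure_lt_top.ne hf.aestronglyMeasurable ?_
  exact (ae_restrict_iff' hS.measurableSet).2 (Eventually.of_forall hC)

/-- Integration by parts for the Jacobian determinant of Lipschitz functions. -/
lemma integral_det_jacobian_mul {m : ℕ} {u : Fin m → En m → ℝ}
    (hu : ∀ i, ∃ K, LipschitzWith K (u i)) {ψ : En m → ℝ} {L : ℝ≥0} (hψ : LipschitzWith L ψ)
    (hc : HasCompactSupport ψ) (i : Fin m) :
    ∫ x, (jacobian u x).det * ψ x = - ∫ x, u i x * (jacobian (Function.update u i ψ) x).det := by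
  obtain ⟨K, hK⟩ := exists_uniform_lipschitzWith hu
  have hupd : ∀ g : En m → ℝ, (∃ C, LipschitzWith C g) →
      ∀ k, ∃ C, LipschitzWith C (Function.update u i g k) := by
    intro g hg k
    by_cases h : k = i
    · subst h; simpa using hg
    · simpa [h] using hu k
  obtain ⟨K', hK'⟩ := exists_uniform_lipschitzWith (hupd ψ ⟨L, hψ⟩)
  have h0 : ∫ x, (jacobian (Function.update u i (fun y => ψ y * u i y)) x).det = 0 :=
    integral_det_jacobian_eq_zero (i₀ := i)
      (hupd _ (exists_lipschitzWith_mul hψ hc (hK i))) (by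
        simp only [Function.update_self]; exact hc.mul_right)
  obtain ⟨M, hM⟩ := hc.isCompact.exists_bound_of_continuousOn (hK i).continuous.continuousOn
  obtain ⟨N, hN⟩ := hc.isCompact.exists_bound_of_continuousOn hψ.continuous.continuousOn
  have i1 : Integrable fun x => (jacobian u x).det * ψ x :=
    integrable_of_bounded_of_isCompact (C := m.factorial * (K : ℝ) ^ m * N)
      ((measurable_det_jacobian u).mul hψ.continuous.measurable) hc.isCompact
      (fun x hx => by rw [image_eq_zero_of_notMem_tsupport hx, mul_zero])
      (fun x hx => by
        rw [abs_mul]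
        exact mul_le_mul (abs_det_jacobian_le hK x) (hN x hx) (abs_nonneg _) (by positivity))
  have i2 : Integrable fun x => u i x * (jacobian (Function.update u i ψ) x).det :=
    integrable_of_bounded_of_isCompact (C := M * (m.factorial * (K' : ℝ) ^ m))
      ((hK i).continuous.measurable.mul (measurable_det_jacobian _)) hc.isCompact
      (fun x hx => by
        rw [det_jacobian_eq_zero_of_notMem_tsupport (i := i) (by simpa using hx), mul_zero])
      (fun x hx => by
        rw [abs_mul]
        exact mul_le_mul (hM x hx) (abs_det_jacobian_le hK' x) (abs_nonneg _)
          ((norm_nonneg _).trans (hM x hx)))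
  rw [eq_neg_iff_add_eq_zero, ← integral_add i1 i2, ← h0]
  refine integral_congr_ae ?_
  filter_upwards [hψ.ae_differentiableAt, (hK i).ae_differentiableAt] with x hx hx'
  have hrow : (fun j => fderiv ℝ (fun y => ψ y * u i y) x (EuclideanSpace.single j 1)) =
      ψ x • (fun j => fderiv ℝ (u i) x (EuclideanSpace.single j 1)) +
        u i x • (fun j => fderiv ℝ ψ x (EuclideanSpace.single j 1)) := by
    ext j
    simp [fderiv_fun_mul hx hx']
  have hself : (jacobian u x).updateRow i
      (fun j => fderiv ℝ (u i) x (EuclideanSpace.single j 1)) = jacobian u x :=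
    Matrix.updateRow_eq_self _ _
  simp only [jacobian_update, hrow]
  rw [Matrix.det_updateRow_add, Matrix.det_updateRow_smul, Matrix.det_updateRow_smul, hself]
  ring

lemma exists_lipschitz_eLpNorm_sub_indicator_le {m : ℕ} {Ω : Set (En m)} (hΩ : IsOpen Ω)
    (hfin : volume Ω ≠ ∞) (c : ℝ) {s : Set (En m)} (hs : MeasurableSet s) {ε : ℝ≥0∞}
    (hε : ε ≠ 0) :
    ∃ g : En m → ℝ, eLpNorm (g - s.indicator fun _ => c) 1 (volume.restrict Ω) ≤ ε ∧
      (∃ L, LipschitzWith L g) ∧ HasCompactSupport g ∧ tsupport g ⊆ Ω := by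
  obtain ⟨η, hη0, hη⟩ : ∃ η : ℝ≥0∞, η ≠ 0 ∧ ENNReal.ofReal |c| * (η + η) ≤ ε := by
    rcases eq_or_ne ε ∞ with rfl | hε'
    · exact ⟨1, one_ne_zero, le_top⟩
    refine ⟨ε / (2 * (ENNReal.ofReal |c| + 1)),
      (ENNReal.div_pos hε (by finiteness)).ne', ?_⟩
    rw [← two_mul, ← mul_assoc, ← mul_div_assoc, mul_comm, mul_div_assoc]
    refine mul_le_of_le_one_right' (ENNReal.div_le_of_le_mul ?_)
    rw [one_mul, mul_comm]
    gcongr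
    exact le_self_add
  have hsΩ : volume (s ∩ Ω) ≠ ∞ := ne_top_of_le_ne_top hfin (measure_mono inter_subset_right)
  obtain ⟨K, hKs, hK, hKε⟩ := (hs.inter hΩ.measurableSet).exists_isCompact_sdiff_lt hsΩ hη0
  obtain ⟨U, hKU, hU, hUε⟩ := hK.exists_isOpen_lt_add (μ := volume) hη0
  have hUK : volume (U \ K) < η :=
    measure_sdiff_lt_of_lt_add hK.measurableSet.nullMeasurableSet hKU hK.measure_lt_top.ne hUε
  obtain ⟨δ, hδ, hδU⟩ := hK.exists_cthickening_subset_open (hU.inter hΩ)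
    (subset_inter hKU (hKs.trans inter_subset_right))
  have hts : tsupport (fun x => c * (thickenedIndicator hδ K x : ℝ)) ⊆ cthickening δ K := by
    refine closure_minimal (fun x hx => ?_) isClosed_cthickening
    by_contra h
    exact hx (by simp [thickenedIndicator_zero hδ K fun h' =>
      h (thickening_subset_cthickening _ _ h')])
  refine ⟨fun x => c * (thickenedIndicator hδ K x : ℝ), ?_, ⟨‖c‖₊ * (1 * δ.toNNReal⁻¹), ?_⟩, ?_,
    hts.trans (hδU.trans inter_subset_right)⟩
  · rw [eLpNorm_one_eq_lintegral_enorm]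
    calc ∫⁻ x in Ω, ‖((fun x => c * (thickenedIndicator hδ K x : ℝ)) -
          s.indicator fun _ => c) x‖ₑ
        ≤ ∫⁻ x in Ω, ENNReal.ofReal |c| *
          (((s ∩ Ω) \ K).indicator 1 x + (U \ K).indicator 1 x) := by
          refine setLIntegral_mono' hΩ.measurableSet fun x hx => ?_
          have h01 : (thickenedIndicator hδ K x : ℝ) ≤ 1 := by
            exact_mod_cast thickenedIndicator_le_one hδ K x
          have h00 : 0 ≤ (thickenedIndicator hδ K x : ℝ) := NNReal.coe_nonneg _
          rw [Pi.sub_apply, Real.enorm_eq_ofReal_abs]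
          by_cases hxK : x ∈ K
          · have : x ∈ s := (hKs hxK).1
            simp [thickenedIndicator_one hδ K hxK, this]
          · by_cases hxU : x ∈ U
            · rw [indicator_of_mem (show x ∈ U \ K from ⟨hxU, hxK⟩), Pi.one_apply]
              refine le_trans ?_ (le_mul_of_one_le_right' le_add_self)
              refine ENNReal.ofReal_le_ofReal ?_
              by_cases hxs : x ∈ s
              · rw [indicator_of_mem hxs, ← mul_sub_one, abs_mul]
                refine mul_le_of_le_one_right (abs_nonneg _) ?_
                rw [abs_le]; constructor <;> linarith
              · rw [indicator_of_notMem hxs, sub_zero, abs_mul]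
                refine mul_le_of_le_one_right (abs_nonneg _) ?_
                rwa [abs_of_nonneg h00]
            · have : x ∉ thickening δ K := fun h =>
                hxU (hδU (thickening_subset_cthickening _ _ h)).1
              by_cases hxs : x ∈ s
              · simp [thickenedIndicator_zero hδ K this, hxs, hx, hxK, hxU]
              · simp [thickenedIndicator_zero hδ K this, hxs]
      _ ≤ ∫⁻ x, ENNReal.ofReal |c| *
          (((s ∩ Ω) \ K).indicator 1 x + (U \ K).indicator 1 x) := setLIntegral_le_lintegral _ _
      _ = ENNReal.ofReal |c| * (volume ((s ∩ Ω) \ K) + volume (U \ K)) := by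
          have h1 : MeasurableSet ((s ∩ Ω) \ K) :=
            (hs.inter hΩ.measurableSet).diff hK.measurableSet
          have h2 : MeasurableSet (U \ K) := hU.measurableSet.diff hK.measurableSet
          rw [lintegral_const_mul _ (by fun_prop (disch := assumption)), lintegral_add_left
            (by fun_prop (disch := assumption)),
            lintegral_indicator_one h1, lintegral_indicator_one h2]
      _ ≤ ENNReal.ofReal |c| * (η + η) := by gcongr
      _ ≤ ε := hη
  · exact (lipschitzWith_smul c).comp
      ((LipschitzWith.subtype_val _).comp (lipschitzWith_thickenedIndicator hδ K))
  · exact hK.cthickening.of_isClosed_subset (isClosed_tsupport _) hts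

/-- Bounded sequences converge weak-* as soon as they converge against Lipschitz functions with
compact support. -/
lemma tendsto_integral_mul_of_forall_lipschitz {m : ℕ} {Ω : Set (En m)} (hΩ : IsOpen Ω)
    (hfin : volume Ω ≠ ∞) {D : ℕ → En m → ℝ} {D₀ : En m → ℝ} {C : ℝ}
    (hDm : ∀ h, Measurable (D h)) (hD₀m : Measurable D₀) (hD : ∀ h x, |D h x| ≤ C)
    (hD₀ : ∀ x, |D₀ x| ≤ C)
    (H : ∀ g : En m → ℝ, (∃ L, LipschitzWith L g) → HasCompactSupport g → tsupport g ⊆ Ω →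
      Tendsto (fun h => ∫ x in Ω, D h x * g x) atTop (𝓝 (∫ x in Ω, D₀ x * g x)))
    {ψ : En m → ℝ} (hψ : IntegrableOn ψ Ω) :
    Tendsto (fun h => ∫ x in Ω, D h x * ψ x) atTop (𝓝 (∫ x in Ω, D₀ x * ψ x)) := by
  have hC : 0 ≤ C := (abs_nonneg _).trans (hD₀ 0)
  have hint : ∀ {E g : En m → ℝ}, Measurable E → (∀ x, |E x| ≤ C) → IntegrableOn g Ω →
      IntegrableOn (fun x => E x * g x) Ω := fun hE hb hg =>
    hg.bdd_mul hE.aestronglyMeasurable (Eventually.of_forall hb)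
  have hclose : ∀ {E g : En m → ℝ} {ε : ℝ}, Measurable E → (∀ x, |E x| ≤ C) →
      IntegrableOn g Ω → ∫ x in Ω, |ψ x - g x| ≤ ε →
      |(∫ x in Ω, E x * ψ x) - ∫ x in Ω, E x * g x| ≤ C * ε := by
    intro E g ε hE hb hg hε
    rw [← integral_sub (hint hE hb hψ) (hint hE hb hg)]
    refine (abs_integral_le_integral_abs).trans ((integral_mono_of_nonneg
      (Eventually.of_forall fun _ => abs_nonneg _)
      ((hψ.sub hg).abs.const_mul C) (Eventually.of_forall fun x => ?_)).trans ?_)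
    · simp only [← mul_sub, abs_mul, Pi.sub_apply]
      exact mul_le_mul_of_nonneg_right (hb x) (abs_nonneg _)
    · rw [integral_const_mul]
      exact mul_le_mul_of_nonneg_left hε hC
  rw [Metric.tendsto_atTop]
  intro ε hε
  set δ : ℝ := ε / (3 * (C + 1)) with hδ
  have hδ0 : 0 < δ := by positivity
  have hCδ : C * δ < ε / 3 := by
    rw [hδ, mul_div_assoc', div_lt_div_iff₀ (by positivity) (by positivity)]
    nlinarith
  obtain ⟨g, hgε, hgL, hgc, hgs⟩ := (memLp_one_iff_integrable.2 hψ).induction_dense one_ne_top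
    (fun g => (∃ L, LipschitzWith L g) ∧ HasCompactSupport g ∧ tsupport g ⊆ Ω)
    (fun c s hs _ ε hε => exists_lipschitz_eLpNorm_sub_indicator_le hΩ hfin c hs hε)
    (fun f g ⟨⟨L, hf⟩, hf', hf''⟩ ⟨⟨L', hg⟩, hg', hg''⟩ => ⟨⟨_, hf.add hg⟩, hf'.add hg',
      (tsupport_add _ _).trans (union_subset hf'' hg'')⟩)
    (fun g ⟨⟨L, hg⟩, _⟩ => hg.continuous.aestronglyMeasurable)
    (ENNReal.ofReal_pos.2 hδ0).ne'
  obtain ⟨L, hL⟩ := hgL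
  have hgi : IntegrableOn g Ω := (hL.continuous.integrable_of_hasCompactSupport hgc).integrableOn
  have hgδ : ∫ x in Ω, |ψ x - g x| ≤ δ := by
    rw [eLpNorm_one_eq_lintegral_enorm] at hgε
    have := integral_norm_eq_lintegral_enorm (hψ.sub hgi).aestronglyMeasurable
    simp only [Real.norm_eq_abs, Pi.sub_apply] at this hgε
    rw [this]
    exact ENNReal.toReal_le_of_le_ofReal hδ0.le hgε
  obtain ⟨N, hN⟩ := Metric.tendsto_atTop.1 (H g ⟨L, hL⟩ hgc hgs) (ε / 3) (by positivity)
  refine ⟨N, fun h hh => ?_⟩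
  have h1 := hclose (hDm h) (hD h) hgi hgδ
  have h2 := hclose hD₀m hD₀ hgi hgδ
  have h3 := hN h hh
  rw [Real.dist_eq] at h3 ⊢
  rw [abs_le] at h1 h2
  rw [abs_lt] at h3 ⊢
  constructor <;> linarith [h1.1, h1.2, h2.1, h2.2, h3.1, h3.2]

/-- A bounded sequence of measurable functions converging weak-* against integrable functions. -/
structure WeakStarTendsto {α : Type*} [MeasurableSpace α] (μ : Measure α) (D : ℕ → α → ℝ)
    (D₀ : α → ℝ) : Prop where
  aestronglyMeasurable : ∀ h, AEStronglyMeasurable (D h) μ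
  aestronglyMeasurable_lim : AEStronglyMeasurable D₀ μ
  bounded : ∃ C, (∀ h, ∀ᵐ x ∂μ, |D h x| ≤ C) ∧ ∀ᵐ x ∂μ, |D₀ x| ≤ C
  tendsto : ∀ ψ, Integrable ψ μ →
    Tendsto (fun h => ∫ x, D h x * ψ x ∂μ) atTop (𝓝 (∫ x, D₀ x * ψ x ∂μ))

namespace WeakStarTendsto

variable {α : Type*} [MeasurableSpace α] {μ : Measure α}

lemma integrable_mul {E ψ : α → ℝ} {C : ℝ} (hE : AEStronglyMeasurable E μ)
    (hb : ∀ᵐ x ∂μ, |E x| ≤ C) (hψ : Integrable ψ μ) : Integrable (fun x => E x * ψ x) μ :=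
  hψ.bdd_mul hE hb

protected lemma congr {D D' : ℕ → α → ℝ} {D₀ D₀' : α → ℝ} (hD : WeakStarTendsto μ D D₀)
    (h : ∀ h, D h =ᵐ[μ] D' h) (h₀ : D₀ =ᵐ[μ] D₀') : WeakStarTendsto μ D' D₀' where
  aestronglyMeasurable k := (hD.1 k).congr (h k)
  aestronglyMeasurable_lim := hD.2.congr h₀
  bounded := by
    obtain ⟨C, hC, hC₀⟩ := hD.bounded
    refine ⟨C, fun k => ?_, ?_⟩
    · filter_upwards [hC k, h k] with x hx hx'; rwa [← hx']
    · filter_upwards [hC₀, h₀] with x hx hx'; rwa [← hx']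
  tendsto ψ hψ := by
    have e : ∀ {E E' : α → ℝ}, E =ᵐ[μ] E' → ∫ x, E x * ψ x ∂μ = ∫ x, E' x * ψ x ∂μ :=
      fun hE => integral_congr_ae (by filter_upwards [hE] with x hx; rw [hx])
    simpa only [e (h _), e h₀] using hD.tendsto ψ hψ

protected lemma zero : WeakStarTendsto μ (fun _ _ => 0) (fun _ => 0) where
  aestronglyMeasurable _ := aestronglyMeasurable_const
  aestronglyMeasurable_lim := aestronglyMeasurable_const
  bounded := ⟨0, by simp, by simp⟩
  tendsto ψ _ := by simp

protected lemma add {D E : ℕ → α → ℝ} {D₀ E₀ : α → ℝ} (hD : WeakStarTendsto μ D D₀)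
    (hE : WeakStarTendsto μ E E₀) :
    WeakStarTendsto μ (fun h x => D h x + E h x) (fun x => D₀ x + E₀ x) where
  aestronglyMeasurable h := (hD.1 h).add (hE.1 h)
  aestronglyMeasurable_lim := hD.2.add hE.2
  bounded := by
    obtain ⟨C, hC, hC₀⟩ := hD.bounded
    obtain ⟨C', hC', hC₀'⟩ := hE.bounded
    refine ⟨C + C', fun k => ?_, ?_⟩
    · filter_upwards [hC k, hC' k] with x hx hx'
      exact (abs_add_le _ _).trans (add_le_add hx hx')
    · filter_upwards [hC₀, hC₀'] with x hx hx'
      exact (abs_add_le _ _).trans (add_le_add hx hx')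
  tendsto ψ hψ := by
    obtain ⟨C, hC, hC₀⟩ := hD.bounded
    obtain ⟨C', hC', hC₀'⟩ := hE.bounded
    have := (hD.tendsto ψ hψ).add (hE.tendsto ψ hψ)
    simp only [add_mul]
    rw [integral_add (integrable_mul hD.2 hC₀ hψ) (integrable_mul hE.2 hC₀' hψ)]
    refine this.congr fun h => ?_
    rw [integral_add (integrable_mul (hD.1 h) (hC h) hψ) (integrable_mul (hE.1 h) (hC' h) hψ)]

protected lemma sum {ι : Type*} (s : Finset ι) {D : ι → ℕ → α → ℝ} {D₀ : ι → α → ℝ}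
    (hD : ∀ i, WeakStarTendsto μ (D i) (D₀ i)) :
    WeakStarTendsto μ (fun h x => ∑ i ∈ s, D i h x) (fun x => ∑ i ∈ s, D₀ i x) := by
  classical
  induction s using Finset.induction_on with
  | empty => simpa using WeakStarTendsto.zero
  | insert i s hi ih => simpa only [Finset.sum_insert hi] using (hD i).add ih

/-- Boundedly and pointwise convergent coefficients may be multiplied into a weak-* limit. -/
protected lemma mul {a D : ℕ → α → ℝ} {a₀ D₀ : α → ℝ} {A : ℝ}
    (ha : ∀ h, AEStronglyMeasurable (a h) μ) (haA : ∀ h, ∀ᵐ x ∂μ, |a h x| ≤ A)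
    (hlim : ∀ᵐ x ∂μ, Tendsto (fun h => a h x) atTop (𝓝 (a₀ x)))
    (hD : WeakStarTendsto μ D D₀) :
    WeakStarTendsto μ (fun h x => a h x * D h x) (fun x => a₀ x * D₀ x) := by
  have ha₀ : AEStronglyMeasurable a₀ μ := aestronglyMeasurable_of_tendsto_ae atTop ha hlim
  have haA₀ : ∀ᵐ x ∂μ, |a₀ x| ≤ A := by
    filter_upwards [hlim, ae_all_iff.2 haA] with x hx hx'
    exact le_of_tendsto hx.abs (Eventually.of_forall hx')
  obtain ⟨C, hC, hC₀⟩ := hD.bounded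
  have hmul : ∀ {s t : ℝ}, |s| ≤ A → |t| ≤ C → |s * t| ≤ A * C := fun hs ht => by
    rw [abs_mul]
    exact mul_le_mul hs ht (abs_nonneg _) ((abs_nonneg _).trans hs)
  refine ⟨fun h => (ha h).mul (hD.1 h), ha₀.mul hD.2, ⟨A * C, fun h => ?_, ?_⟩, fun ψ hψ => ?_⟩
  · filter_upwards [haA h, hC h] with x hx hx' using hmul hx hx'
  · filter_upwards [haA₀, hC₀] with x hx hx' using hmul hx hx'
  have h1 : Tendsto (fun h => ∫ x, (a h x - a₀ x) * (D h x * ψ x) ∂μ) atTop (𝓝 0) := by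
    rw [← integral_zero α ℝ (μ := μ)]
    refine tendsto_integral_of_dominated_convergence (fun x => (A + A) * (C * |ψ x|))
      (fun h => ((ha h).sub ha₀).mul ((hD.1 h).mul hψ.1)) ((hψ.abs.const_mul C).const_mul _)
      (fun h => ?_) ?_
    · filter_upwards [haA h, haA₀, hC h] with x hx hx₀ hx'
      rw [Real.norm_eq_abs, abs_mul, abs_mul]
      have := (abs_sub (a h x) (a₀ x)).trans (add_le_add hx hx₀)
      have hC0 : 0 ≤ C := (abs_nonneg _).trans hx'
      exact mul_le_mul this (mul_le_mul_of_nonneg_right hx' (abs_nonneg _)) (by positivity)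
        ((abs_nonneg _).trans this)
    · filter_upwards [hlim, ae_all_iff.2 hC] with x hx hx'
      refine squeeze_zero_norm (a := fun h => |a h x - a₀ x| * (C * |ψ x|)) (fun h => ?_) ?_
      · rw [Real.norm_eq_abs, abs_mul, abs_mul]
        exact mul_le_mul_of_nonneg_left (mul_le_mul_of_nonneg_right (hx' h) (abs_nonneg _))
          (abs_nonneg _)
      · have := ((hx.sub_const (a₀ x)).abs).mul_const (C * |ψ x|)
        simpa using this
  have h2 := hD.tendsto _ (integrable_mul ha₀ haA₀ hψ)
  have h3 := h1.add h2
  rw [zero_add] at h3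
  have e : ∫ x, a₀ x * D₀ x * ψ x ∂μ = ∫ x, D₀ x * (a₀ x * ψ x) ∂μ := by
    congr 1; ext x; ring
  rw [e]
  refine h3.congr fun h => ?_
  have i1 := integrable_mul (ha h) (haA h) (integrable_mul (hD.1 h) (hC h) hψ)
  have i2 := integrable_mul ha₀ haA₀ (integrable_mul (hD.1 h) (hC h) hψ)
  have i3 := integrable_mul (hD.1 h) (hC h) (integrable_mul ha₀ haA₀ hψ)
  rw [← integral_add (by simpa only [sub_mul] using! i1.sub i2) i3]
  congr 1; ext x; ring

end WeakStarTendsto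

/-- Jacobian determinants of uniformly Lipschitz maps are weak-* continuous. -/
lemma weakStarTendsto_det_jacobian {m : ℕ} {Ω : Set (En m)} (hΩ : IsOpen Ω)
    (hfin : volume Ω ≠ ∞) {u : ℕ → Fin m → En m → ℝ} {v : Fin m → En m → ℝ} {K : ℝ≥0} {M : ℝ}
    (hu : ∀ h i, LipschitzWith K (u h i)) (hv : ∀ i, LipschitzWith K (v i))
    (huM : ∀ h i, ∀ x ∈ Ω, |u h i x| ≤ M)
    (hlim : ∀ i, ∀ x ∈ Ω, Tendsto (fun h => u h i x) atTop (𝓝 (v i x))) :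
    WeakStarTendsto (volume.restrict Ω) (fun h x => (jacobian (u h) x).det)
      (fun x => (jacobian v x).det) := by
  suffices H : ∀ S : Finset (Fin m), ∀ (u : ℕ → Fin m → En m → ℝ) (v : Fin m → En m → ℝ)
      (K : ℝ≥0) (M : ℝ), (∀ h i, LipschitzWith K (u h i)) → (∀ i, LipschitzWith K (v i)) →
      (∀ h i, ∀ x ∈ Ω, |u h i x| ≤ M) →
      (∀ i, ∀ x ∈ Ω, Tendsto (fun h => u h i x) atTop (𝓝 (v i x))) →
      (∀ i ∉ S, ∀ h, u h i = v i) →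
      WeakStarTendsto (volume.restrict Ω) (fun h x => (jacobian (u h) x).det)
        (fun x => (jacobian v x).det) from
    H Finset.univ u v K M hu hv huM hlim fun i hi => absurd (Finset.mem_univ i) hi
  clear! u v K M
  intro S
  induction S using Finset.induction_on with
  | empty =>
    intro u v K M hu hv huM hlim hS
    have : ∀ h, u h = v := fun h => funext fun i => hS i (Finset.notMem_empty i) h
    simp only [this]
    have hm := (measurable_det_jacobian v).aestronglyMeasurable (μ := volume.restrict Ω)
    have hb := Eventually.of_forall (f := ae (volume.restrict Ω)) (abs_det_jacobian_le hv)
    exact ⟨fun _ => hm, hm, ⟨_, fun _ => hb, hb⟩, fun _ _ => tendsto_const_nhds⟩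
  | insert i S hi ih =>
    intro u v K M hu hv huM hlim hS
    refine ⟨fun h => (measurable_det_jacobian _).aestronglyMeasurable,
      (measurable_det_jacobian _).aestronglyMeasurable,
      ⟨m.factorial * (K : ℝ) ^ m, fun h => Eventually.of_forall (abs_det_jacobian_le (hu h)),
        Eventually.of_forall (abs_det_jacobian_le hv)⟩, fun ψ hψ => ?_⟩
    refine tendsto_integral_mul_of_forall_lipschitz hΩ hfin
      (fun h => measurable_det_jacobian _) (measurable_det_jacobian _)
      (fun h => abs_det_jacobian_le (hu h)) (abs_det_jacobian_le hv) ?_ hψ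
    rintro g ⟨L, hg⟩ hgc hgs
    obtain ⟨N, hN⟩ := hgc.exists_bound_of_continuous hg.continuous
    have hupd : ∀ w : Fin m → En m → ℝ, (∀ k, LipschitzWith K (w k)) →
        ∀ k, LipschitzWith (max K L) (Function.update w i g k) := by
      intro w hw k
      by_cases h : k = i
      · subst h; simpa using hg.weaken (le_max_right _ _)
      · simpa [h] using (hw k).weaken (le_max_left _ _)
    have hE := ih (fun h => Function.update (u h) i g) (Function.update v i g) (max K L) (max M N)
      (fun h => hupd _ (hu h)) (hupd _ hv)
      (fun h k x hx => by
        by_cases hk : k = i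
        · subst hk; simpa using Or.inr (hN x)
        · simpa [hk] using Or.inl (huM h k x hx))
      (fun k x hx => by
        by_cases hk : k = i
        · subst hk; simp
        · simpa [hk] using hlim k x hx)
      (fun k hk h => by
        by_cases hki : k = i
        · subst hki; simp
        · simpa [hki] using hS k (by simp [hki, hk]) h)
    have hp : ∀ w : Fin m → En m → ℝ, (∀ k, LipschitzWith K (w k)) →
        ∫ x in Ω, (jacobian w x).det * g x =
          - ∫ x in Ω, w i x * (jacobian (Function.update w i g) x).det * 1 := by
      intro w hw
      rw [setIntegral_eq_integral_of_forall_compl_eq_zero,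
        setIntegral_eq_integral_of_forall_compl_eq_zero,
        integral_det_jacobian_mul (fun k => ⟨K, hw k⟩) hg hgc i]
      · simp
      · intro x hx
        rw [det_jacobian_eq_zero_of_notMem_tsupport (i := i)
          (by simpa using fun h => hx (hgs h)), mul_zero, zero_mul]
      · intro x hx
        rw [image_eq_zero_of_notMem_tsupport fun h => hx (hgs h), mul_zero]
    simp only [hp _ (hu _), hp _ hv]
    have hmul := WeakStarTendsto.mul (a := fun h => u h i) (A := M)
      (fun h => (hu h i).continuous.aestronglyMeasurable)
      (fun h => (ae_restrict_iff' hΩ.measurableSet).2 (Eventually.of_forall (huM h i)))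
      ((ae_restrict_iff' hΩ.measurableSet).2 (Eventually.of_forall (hlim i))) hE
    have : IsFiniteMeasure (volume.restrict Ω) := ⟨by simpa using hfin.lt_top⟩
    exact (hmul.tendsto (fun _ => 1) (integrable_const _)).neg

lemma det_sum_smul_rows {m : ℕ} {ι : Type*} [Fintype ι] (a : Fin m → ι → ℝ)
    (R : Fin m → ι → Fin m → ℝ) :
    (Matrix.of fun i j => ∑ r, a i r * R i r j).det =
      ∑ ρ : Fin m → ι, (∏ i, a i (ρ i)) * (Matrix.of fun i j => R i (ρ i) j).det := by
  have h := (Matrix.detRowAlternating (n := Fin m) (R := ℝ)).toMultilinearMap.map_sum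
    (fun i r => a i r • R i r)
  simp only [MultilinearMap.map_smul_univ] at h
  convert h using 1
  · refine congrArg Matrix.det ?_
    ext i j
    simp [Finset.sum_apply]
  · rfl

lemma one_le_det_Gmat (n : ℕ) (f : En (n - 1) → ℝ) (x : En (n - 1)) : 1 ≤ (Gmat n f x).det := by
  have h : Gmat n f x = 1 + Matrix.replicateCol Unit (fun i => pd n f i x) *
      Matrix.replicateRow Unit (fun i => pd n f i x) := by
    ext i j
    simp [Gmat, Matrix.mul_apply, Matrix.one_apply]
  rw [h, Matrix.det_one_add_replicateCol_mul_replicateRow]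
  exact le_add_of_nonneg_right (Finset.sum_nonneg fun i _ => mul_self_nonneg _)

lemma eval_charpoly_inv_mul {m : ℕ} {G B : Matrix (Fin m) (Fin m) ℝ} (hG : G.det ≠ 0) (t : ℝ) :
    (G⁻¹ * B).charpoly.eval t = G.det⁻¹ * (t • G - B).det := by
  have hG' : IsUnit G.det := isUnit_iff_ne_zero.2 hG
  have h : Matrix.scalar _ t - G⁻¹ * B = G⁻¹ * (t • G - B) := by
    rw [mul_sub, Matrix.mul_smul, Matrix.nonsing_inv_mul _ hG', Matrix.scalar_apply,
      Matrix.smul_one_eq_diagonal]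
  rw [Matrix.eval_charpoly, h, Matrix.det_mul, Matrix.det_nonsing_inv, Ring.inverse_eq_inv']

lemma exists_Kp_eq_sum (n p : ℕ) : ∃ w : Fin (n - 1 + 1) → ℝ, ∀ (f : En (n - 1) → ℝ) x,
    Kp n f p x = ∑ s, w s * ((Gmat n f x).det⁻¹ *
      (((s : ℕ) : ℝ) • Gmat n f x - Bmat n f x).det) := by
  obtain ⟨w, hw⟩ := exists_coeff_eq_sum_eval (n - 1) (n - 1 - p) (fun s => ((s : ℕ) : ℝ))
    (fun a b h => Fin.ext (Nat.cast_injective h))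
  refine ⟨fun s => ((n - 1).choose p : ℝ)⁻¹ * (-1) ^ p * w s, fun f x => ?_⟩
  have hG : (Gmat n f x).det ≠ 0 := (zero_lt_one.trans_le (one_le_det_Gmat n f x)).ne'
  rw [Kp, hw _ (by simp [Matrix.charpoly_natDegree_eq_dim]), ← mul_assoc, Finset.mul_sum]
  simp only [eval_charpoly_inv_mul hG, mul_assoc]

lemma measurable_pd (n : ℕ) (f : En (n - 1) → ℝ) (i : Fin (n - 1)) : Measurable (pd n f i) :=
  measurable_fderiv_apply_const ℝ _ _

lemma abs_pd_le (n : ℕ) (f : En (n - 1) → ℝ) (i : Fin (n - 1)) (x : En (n - 1)) :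
    |pd n f i x| ≤ ‖fderiv ℝ f x‖ := by
  simpa [pd] using (fderiv ℝ f x).le_opNorm (EuclideanSpace.single i (1 : ℝ))

lemma lipschitzOnWith_pd (n : ℕ) {f : En (n - 1) → ℝ} {Ω : Set (En (n - 1))} {K : ℝ≥0}
    (hf : LipschitzOnWith K (fun x => fderiv ℝ f x) Ω) (i : Fin (n - 1)) :
    LipschitzOnWith K (pd n f i) Ω := by
  refine LipschitzOnWith.of_dist_le_mul fun x hx y hy => le_trans ?_ (hf.dist_le_mul x hx y hy)
  rw [Real.dist_eq, dist_eq_norm, pd, pd, ← _root_.sub_apply]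
  simpa using (fderiv ℝ f x - fderiv ℝ f y).le_opNorm (EuclideanSpace.single i (1 : ℝ))

lemma measurable_Gmat (n : ℕ) (f : En (n - 1) → ℝ) (i j : Fin (n - 1)) :
    Measurable fun x => Gmat n f x i j :=
  ((measurable_pd n f i).mul (measurable_pd n f j)).const_add _

lemma abs_Gmat_le (n : ℕ) {f : En (n - 1) → ℝ} {x : En (n - 1)} {c : ℝ}
    (hc : ‖fderiv ℝ f x‖ ≤ c) (i j : Fin (n - 1)) : |Gmat n f x i j| ≤ 1 + c * c := by
  refine (abs_add_le _ _).trans (add_le_add (by split_ifs <;> simp) ?_)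
  rw [abs_mul]
  exact mul_le_mul ((abs_pd_le n f i x).trans hc) ((abs_pd_le n f j x).trans hc) (abs_nonneg _)
    ((norm_nonneg _).trans hc)

lemma tendsto_Gmat (n : ℕ) {fh : ℕ → En (n - 1) → ℝ} {f : En (n - 1) → ℝ} {x : En (n - 1)}
    (hx : Tendsto (fun h => fderiv ℝ (fh h) x) atTop (𝓝 (fderiv ℝ f x))) (i j : Fin (n - 1)) :
    Tendsto (fun h => Gmat n (fh h) x i j) atTop (𝓝 (Gmat n f x i j)) := by
  have hpd : ∀ i, Tendsto (fun h => pd n (fh h) i x) atTop (𝓝 (pd n f i x)) := fun i =>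
    ((ContinuousLinearMap.apply ℝ ℝ (EuclideanSpace.single i (1 : ℝ))).continuous.tendsto _).comp hx
  exact ((hpd i).mul (hpd j)).const_add _

/-- The coefficients in the expansion of the rows of `t • G - B` along the gradients of the first
derivatives (`none`) and of the coordinates (`some k`). -/
def rowCoeff (n : ℕ) (t : ℝ) (f : En (n - 1) → ℝ) (i : Fin (n - 1)) :
    Option (Fin (n - 1)) → En (n - 1) → ℝ
  | none, x => -(Real.sqrt (1 + ‖fderiv ℝ f x‖ ^ 2))⁻¹
  | some k, x => t * Gmat n f x i k

lemma measurable_rowCoeff (n : ℕ) (t : ℝ) (f : En (n - 1) → ℝ) (i : Fin (n - 1))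
    (r : Option (Fin (n - 1))) : Measurable (rowCoeff n t f i r) := by
  cases r with
  | none => exact ((((measurable_fderiv ℝ f).norm.pow_const 2).const_add 1).sqrt).inv.neg
  | some k => exact (measurable_Gmat n f i k).const_mul t

lemma abs_rowCoeff_le (n : ℕ) (t : ℝ) {f : En (n - 1) → ℝ} {x : En (n - 1)} {c : ℝ}
    (hc : ‖fderiv ℝ f x‖ ≤ c) (i : Fin (n - 1)) (r : Option (Fin (n - 1))) :
    |rowCoeff n t f i r x| ≤ 1 + |t| * (1 + c * c) := by
  have hc0 : 0 ≤ c := (norm_nonneg _).trans hc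
  cases r with
  | none =>
    rw [rowCoeff, abs_neg, abs_of_nonneg (by positivity)]
    refine (inv_le_one_of_one_le₀ ?_).trans (le_add_of_nonneg_right (by positivity))
    rw [Real.one_le_sqrt]
    exact le_add_of_nonneg_right (by positivity)
  | some k =>
    rw [rowCoeff, abs_mul]
    exact (mul_le_mul_of_nonneg_left (abs_Gmat_le n hc i k) (abs_nonneg _)).trans
      (le_add_of_nonneg_left zero_le_one)

lemma tendsto_rowCoeff (n : ℕ) (t : ℝ) {fh : ℕ → En (n - 1) → ℝ} {f : En (n - 1) → ℝ}
    {x : En (n - 1)} (hx : Tendsto (fun h => fderiv ℝ (fh h) x) atTop (𝓝 (fderiv ℝ f x)))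
    (i : Fin (n - 1)) (r : Option (Fin (n - 1))) :
    Tendsto (fun h => rowCoeff n t (fh h) i r x) atTop (𝓝 (rowCoeff n t f i r x)) := by
  cases r with
  | none =>
    refine Tendsto.neg (Tendsto.inv₀ (((hx.norm.pow 2).const_add 1).sqrt) ?_)
    positivity
  | some k => exact (tendsto_Gmat n hx i k).const_mul t

/-- The functions whose gradients span the rows of `t • G - B`. -/
def rowFun {m : ℕ} (P : Fin m → En m → ℝ) (i : Fin m) : Option (Fin m) → En m → ℝ
  | none => P i
  | some k => fun x => x k

lemma lipschitzWith_rowFun {m : ℕ} {P : Fin m → En m → ℝ} {K : ℝ≥0}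
    (hP : ∀ i, LipschitzWith K (P i)) (i : Fin m) (r : Option (Fin m)) :
    LipschitzWith (max K 1) (rowFun P i r) := by
  cases r with
  | none => exact (hP i).weaken (le_max_left _ _)
  | some k =>
    refine LipschitzWith.weaken (LipschitzWith.of_dist_le_mul fun x y => ?_) (le_max_right K 1)
    rw [NNReal.coe_one, one_mul, dist_eq_norm, dist_eq_norm]
    exact PiLp.norm_apply_le (x - y) k

lemma det_smul_Gmat_sub_Bmat (n : ℕ) (t : ℝ) {f : En (n - 1) → ℝ} {Ω : Set (En (n - 1))}
    (hΩ : IsOpen Ω) {P : Fin (n - 1) → En (n - 1) → ℝ} (hP : ∀ i, EqOn (pd n f i) (P i) Ω)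
    {x : En (n - 1)} (hx : x ∈ Ω) :
    (t • Gmat n f x - Bmat n f x).det =
      ∑ ρ : Fin (n - 1) → Option (Fin (n - 1)), (∏ i, rowCoeff n t f i (ρ i) x) *
        (jacobian (fun i => rowFun P i (ρ i)) x).det := by
  refine Eq.trans ?_ (det_sum_smul_rows (fun i r => rowCoeff n t f i r x)
    (fun i r j => fderiv ℝ (rowFun P i r) x (EuclideanSpace.single j 1)))
  congr 1
  ext i j
  have h1 : pd2 n f i j x = fderiv ℝ (P i) x (EuclideanSpace.single j 1) := by
    rw [pd2, ((hP i).eventuallyEq_of_mem (hΩ.mem_nhds hx)).fderiv_eq]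
  have h2 : ∀ k : Fin (n - 1), fderiv ℝ (fun x : En (n - 1) => x k) x (EuclideanSpace.single j 1)
      = if k = j then 1 else 0 := by
    intro k
    have : HasFDerivAt (fun x : En (n - 1) => x k)
        (EuclideanSpace.proj k : En (n - 1) →L[ℝ] ℝ) x :=
      (EuclideanSpace.proj k : En (n - 1) →L[ℝ] ℝ).hasFDerivAt
    rw [this.fderiv]
    simp [PiLp.single_apply]
  simp only [Matrix.of_apply, Fintype.sum_option, rowCoeff, rowFun, h2, ← h1]
  simp [Bmat]
  ring

/-- The elementary symmetric curvatures pass to the weak-* limit. -/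
lemma weakStarTendsto_Kp (n : ℕ) {Ω : Set (En (n - 1))} (hΩ : IsOpen Ω)
    (hΩb : Bornology.IsBounded Ω) {fh : ℕ → En (n - 1) → ℝ} {f : En (n - 1) → ℝ} {c : ℝ}
    {K : ℝ≥0} (hbd : ∀ h, ∀ x ∈ Ω, ‖fderiv ℝ (fh h) x‖ ≤ c)
    (hlip : ∀ h, LipschitzOnWith K (fun x => fderiv ℝ (fh h) x) Ω)
    (hflip : LipschitzOnWith K (fun x => fderiv ℝ f x) Ω)
    (hlim : ∀ x ∈ Ω, Tendsto (fun h => fderiv ℝ (fh h) x) atTop (𝓝 (fderiv ℝ f x))) (p : ℕ) :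
    WeakStarTendsto (volume.restrict Ω) (fun h => Kp n (fh h) p) (Kp n f p) := by
  have hae : ∀ {q : En (n - 1) → Prop}, (∀ x ∈ Ω, q x) → ∀ᵐ x ∂volume.restrict Ω, q x :=
    fun h => (ae_restrict_iff' hΩ.measurableSet).2 (Eventually.of_forall h)
  have hfin : volume Ω ≠ ∞ := hΩb.measure_lt_top.ne
  obtain ⟨R, hR⟩ := hΩb.exists_norm_le
  have hext : ∀ h i, ∃ g : En (n - 1) → ℝ, LipschitzWith K g ∧ EqOn (pd n (fh h) i) g Ω :=
    fun h i => (lipschitzOnWith_pd n (hlip h) i).extend_real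
  have hext' : ∀ i, ∃ g : En (n - 1) → ℝ, LipschitzWith K g ∧ EqOn (pd n f i) g Ω :=
    fun i => (lipschitzOnWith_pd n hflip i).extend_real
  choose P hPK hP using hext
  choose Q hQK hQ using hext'
  have hjac : ∀ ρ : Fin (n - 1) → Option (Fin (n - 1)), WeakStarTendsto (volume.restrict Ω)
      (fun h x => (jacobian (fun i => rowFun (P h) i (ρ i)) x).det)
      (fun x => (jacobian (fun i => rowFun Q i (ρ i)) x).det) := by
    intro ρ
    refine weakStarTendsto_det_jacobian hΩ hfin (M := max c R)
      (fun h i => lipschitzWith_rowFun (hPK h) i _) (fun i => lipschitzWith_rowFun hQK i _) ?_ ?_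
    · intro h i x hx
      rcases ρ i with _ | k
      · rw [rowFun, ← hP h i hx]
        exact ((abs_pd_le n _ i x).trans (hbd h x hx)).trans (le_max_left _ _)
      · exact ((PiLp.norm_apply_le x k).trans (hR x hx)).trans (le_max_right _ _)
    · intro i x hx
      rcases ρ i with _ | k
      · simp only [rowFun, ← hP _ i hx, ← hQ i hx]
        exact ((ContinuousLinearMap.apply ℝ ℝ
          (EuclideanSpace.single i (1 : ℝ))).continuous.tendsto _).comp (hlim x hx)
      · exact tendsto_const_nhds
  have hdet : ∀ t : ℝ, WeakStarTendsto (volume.restrict Ω)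
      (fun h x => (t • Gmat n (fh h) x - Bmat n (fh h) x).det)
      (fun x => (t • Gmat n f x - Bmat n f x).det) := by
    intro t
    refine (WeakStarTendsto.sum Finset.univ fun ρ : Fin (n - 1) → Option (Fin (n - 1)) =>
      WeakStarTendsto.mul (a := fun h x => ∏ i, rowCoeff n t (fh h) i (ρ i) x)
        (a₀ := fun x => ∏ i, rowCoeff n t f i (ρ i) x) (A := (1 + |t| * (1 + c * c)) ^ (n - 1))
        ?_ ?_ ?_ (hjac ρ)).congr
      (fun h => hae fun x hx => (det_smul_Gmat_sub_Bmat n t hΩ (hP h) hx).symm)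
      (hae fun x hx => (det_smul_Gmat_sub_Bmat n t hΩ hQ hx).symm)
    · exact fun h => (Finset.measurable_prod _ fun i _ =>
        measurable_rowCoeff n t (fh h) i (ρ i)).aestronglyMeasurable
    · refine fun h => hae fun x hx => ?_
      rw [Finset.abs_prod]
      refine (Finset.prod_le_prod (fun _ _ => abs_nonneg _)
        fun i _ => abs_rowCoeff_le n t (hbd h x hx) i (ρ i)).trans ?_
      simp
    · exact hae fun x hx => tendsto_finsetProd _ fun i _ => tendsto_rowCoeff n t (hlim x hx) i (ρ i)
  obtain ⟨w, hw⟩ := exists_Kp_eq_sum n p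
  refine (WeakStarTendsto.sum Finset.univ fun s : Fin (n - 1 + 1) =>
    WeakStarTendsto.mul (a := fun h x => w s * (Gmat n (fh h) x).det⁻¹)
      (a₀ := fun x => w s * (Gmat n f x).det⁻¹) (A := |w s|) ?_ ?_ ?_ (hdet (s : ℕ))).congr
    (fun h => Eventually.of_forall fun x => ?_) (Eventually.of_forall fun x => ?_)
  · exact fun h => ((measurable_det_of_entries (measurable_Gmat n (fh h))).inv.const_mul
      (w s)).aestronglyMeasurable
  · refine fun h => Eventually.of_forall fun x => ?_
    have := one_le_det_Gmat n (fh h) x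
    rw [abs_mul, abs_of_nonneg (inv_nonneg.2 (zero_le_one.trans this))]
    exact mul_le_of_le_one_right (abs_nonneg _) (inv_le_one_of_one_le₀ this)
  · refine hae fun x hx => (Tendsto.inv₀ ?_ ?_).const_mul _
    · simp only [Matrix.det_apply']
      exact tendsto_finsetSum _ fun σ _ => (tendsto_finsetProd _ fun i _ =>
        tendsto_Gmat n (hlim x hx) _ _).const_mul _
    · exact (zero_lt_one.trans_le (one_le_det_Gmat n f x)).ne'
  · simp only [hw, mul_assoc]
  · simp only [hw, mul_assoc]

lemma exists_bounded_measurable_selection {Y : Type*} [TopologicalSpace Y]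
    [SecondCountableTopology Y] [MeasurableSpace Y] [OpensMeasurableSpace Y] {m : ℕ} {S : Set Y}
    (hS : IsCompact S) {Q : (Fin m → ℝ) → Y → Prop} (hQ : ∀ y, ∃ a, ∀ᶠ z in 𝓝 y, Q a z) :
    ∃ A : Y → Fin m → ℝ, (∀ i, Measurable fun y => A y i) ∧ (∀ y, Q (A y) y) ∧
      ∃ C, ∀ y ∈ S, ∀ i, |A y i| ≤ C := by
  classical
  rcases isEmpty_or_nonempty Y with hY | ⟨⟨y₀⟩⟩
  · exact ⟨fun _ _ => 0, fun _ => measurable_const, fun y => hY.elim y, 0, fun y => hY.elim y⟩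
  choose a ha using hQ
  obtain ⟨s, hs, hsU⟩ := TopologicalSpace.countable_cover_nhds
    (f := fun y => interior {z | Q (a y) z}) fun y => interior_mem_nhds.2 (ha y)
  have hsn : s.Nonempty := by
    by_contra h
    rw [not_nonempty_iff_eq_empty] at h
    subst h
    simpa using hsU.symm.subset (mem_univ y₀)
  obtain ⟨e, rfl⟩ := hs.exists_eq_range hsn
  rw [biUnion_range] at hsU
  have hex : ∀ y, ∃ k, y ∈ interior {z | Q (a (e k)) z} := fun y =>
    mem_iUnion.1 (hsU.symm.subset (mem_univ y))
  have hfind : Measurable fun y => Nat.find (hex y) :=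
    measurable_find hex fun k => isOpen_interior.measurableSet
  refine ⟨fun y => a (e (Nat.find (hex y))), fun i => ?_, fun y => ?_, ?_⟩
  · exact (measurable_from_nat (f := fun k => a (e k) i)).comp hfind
  · exact interior_subset (s := {z | Q (a (e (Nat.find (hex y)))) z}) (Nat.find_spec (hex y))
  · obtain ⟨t, ht⟩ := hS.elim_finite_subcover _ (fun k => isOpen_interior)
      (fun y _ => hsU.symm.subset (mem_univ y))
    refine ⟨∑ k ∈ Finset.range (t.sup id + 1), ∑ i, |a (e k) i|, fun y hy i => ?_⟩
    obtain ⟨k, hk, hyk⟩ := mem_iUnion₂.1 (ht hy)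
    have hle : Nat.find (hex y) ≤ t.sup id :=
      (Nat.find_min' (hex y) hyk).trans (Finset.le_sup (f := id) hk)
    refine (Finset.single_le_sum (f := fun i => |a (e (Nat.find (hex y))) i|)
      (fun _ _ => abs_nonneg _) (Finset.mem_univ i)).trans
      (Finset.single_le_sum (f := fun k => ∑ i, |a (e k) i|)
      (fun _ _ => Finset.sum_nonneg fun _ _ => abs_nonneg _)
      (Finset.mem_range.2 (Nat.lt_succ_of_le hle)))

lemma map_eq_sum_mul {m : ℕ} (l : En m →L[ℝ] ℝ) (v : En m) :
    l v = ∑ i, l (EuclideanSpace.single i 1) * v i := by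
  conv_lhs => rw [← (EuclideanSpace.basisFun (Fin m) ℝ).sum_repr v]
  simp [mul_comm]

/-- Approximate subgradients may be chosen locally constant. -/
lemma exists_eventually_affine_le {m : ℕ} {Z : Type*} [TopologicalSpace Z] {Φ : Z × En m → ℝ}
    (hΦ : Continuous Φ) (hconv : ∀ q, ConvexOn ℝ univ fun v => Φ (q, v)) {R : Set (En m)}
    (hR : IsCompact R) {η : ℝ} (hη : 0 < η) (y : Z × En m) :
    ∃ a : Fin m → ℝ, ∀ᶠ z in 𝓝 y, ∀ v ∈ R,
      Φ z + ∑ i, a i * (v i - z.2 i) ≤ Φ (z.1, v) + η := by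
  obtain ⟨l, c, hl, hlc⟩ := (hconv y.1).exists_affine_le_of_lt (𝕜 := ℝ) (mem_univ y.2)
    (show Φ y - η / 2 < Φ (y.1, y.2) by simp [hη]) isClosed_univ
    (hΦ.comp (by fun_prop : Continuous fun v => (y.1, v))).continuousOn.lowerSemicontinuousOn
  refine ⟨fun i => l (EuclideanSpace.single i 1), hR.eventually_forall_of_forall_eventually
    (P := fun z v => Φ z + ∑ i, l (EuclideanSpace.single i 1) * (v i - z.2 i) ≤ Φ (z.1, v) + η)
    fun v _ => ?_⟩
  have hcont : Continuous fun p : (Z × En m) × En m =>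
      Φ (p.1.1, p.2) + η - (Φ p.1 + l (p.2 - p.1.2)) := by fun_prop
  have hpos : 0 < Φ (y.1, v) + η - (Φ y + l (v - y.2)) := by
    have h1 := hl ⟨v, mem_univ v⟩
    simp only [Pi.add_apply, domRestrict_apply, Function.comp_apply, RCLike.re_to_real,
      Function.const_apply] at h1 hlc
    rw [map_sub]
    linarith
  filter_upwards [hcont.continuousAt.eventually (lt_mem_nhds hpos)] with p hp
  have := map_eq_sum_mul l (p.2 - p.1.2)
  simp only [PiLp.sub_apply] at this
  rw [← this]
  linarith

lemma aestronglyMeasurable_of_forall_apply {α : Type*} [MeasurableSpace α] {μ : Measure α} {m : ℕ}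
    {w : α → En m} (hw : ∀ i, AEStronglyMeasurable (fun x => w x i) μ) :
    AEStronglyMeasurable w μ :=
  (PiLp.continuous_toLp 2 fun _ : Fin m => ℝ).comp_aestronglyMeasurable
    (aemeasurable_pi_iff.2 fun i => (hw i).aemeasurable).aestronglyMeasurable

lemma mem_closedBall_sum {m : ℕ} {v : En m} {C : Fin m → ℝ} (hv : ∀ i, |v i| ≤ C i) :
    v ∈ closedBall (0 : En m) (∑ i, C i) := by
  rw [mem_closedBall_zero_iff, ← (EuclideanSpace.basisFun (Fin m) ℝ).sum_repr v]
  refine (norm_sum_le _ _).trans (Finset.sum_le_sum fun i _ => ?_)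
  simpa [norm_smul] using hv i

lemma ae_norm_comp_le {α Y Z : Type*} [MeasurableSpace α] {μ : Measure α} {Φ : Z × Y → ℝ}
    {S : Set Z} {R : Set Y} {B : ℝ} (hB : ∀ p ∈ S ×ˢ R, ‖Φ p‖ ≤ B) {y : α → Z} {w : α → Y}
    (hyS : ∀ᵐ x ∂μ, y x ∈ S) (hwR : ∀ᵐ x ∂μ, w x ∈ R) : ∀ᵐ x ∂μ, ‖Φ (y x, w x)‖ ≤ B := by
  filter_upwards [hyS, hwR] with x hx hx' using hB _ ⟨hx, hx'⟩

section Integrands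

variable {α : Type*} [MeasurableSpace α] {μ : Measure α} [IsFiniteMeasure μ] {m : ℕ} {Z : Type*}
  [MetricSpace Z] {Φ : Z × En m → ℝ} {S : Set Z} {R : Set (En m)}

lemma integrable_comp_of_isCompact (hΦ : Continuous Φ) (hS : IsCompact S) (hR : IsCompact R)
    {y : α → Z} {w : α → En m} (hy : AEStronglyMeasurable y μ) (hw : AEStronglyMeasurable w μ)
    (hyS : ∀ᵐ x ∂μ, y x ∈ S) (hwR : ∀ᵐ x ∂μ, w x ∈ R) :
    Integrable (fun x => Φ (y x, w x)) μ := by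
  obtain ⟨B, hB⟩ := (hS.prod hR).exists_bound_of_continuousOn hΦ.continuousOn
  exact Integrable.of_bound (hΦ.comp_aestronglyMeasurable (hy.prodMk hw)) B
    (ae_norm_comp_le hB hyS hwR)

lemma tendsto_integral_sub_of_tendsto_param (hΦ : Continuous Φ) (hS : IsCompact S)
    (hR : IsCompact R) {z : ℕ → α → Z} {z₀ : α → Z} {κ : ℕ → α → En m}
    (hz : ∀ h, AEStronglyMeasurable (z h) μ) (hz₀ : AEStronglyMeasurable z₀ μ)
    (hκ : ∀ h, AEStronglyMeasurable (κ h) μ) (hzS : ∀ h, ∀ᵐ x ∂μ, z h x ∈ S)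
    (hz₀S : ∀ᵐ x ∂μ, z₀ x ∈ S) (hκR : ∀ h, ∀ᵐ x ∂μ, κ h x ∈ R)
    (hlim : ∀ᵐ x ∂μ, Tendsto (fun h => z h x) atTop (𝓝 (z₀ x))) :
    Tendsto (fun h => ∫ x, (Φ (z h x, κ h x) - Φ (z₀ x, κ h x)) ∂μ) atTop (𝓝 0) := by
  obtain ⟨B, hB⟩ := (hS.prod hR).exists_bound_of_continuousOn hΦ.continuousOn
  have huc := Metric.uniformContinuousOn_iff.1
    ((hS.prod hR).uniformContinuousOn_of_continuous hΦ.continuousOn)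
  rw [← integral_zero α ℝ (μ := μ)]
  refine tendsto_integral_of_dominated_convergence (fun _ => B + B)
    (fun h => (hΦ.comp_aestronglyMeasurable ((hz h).prodMk (hκ h))).sub
      (hΦ.comp_aestronglyMeasurable (hz₀.prodMk (hκ h)))) (integrable_const _) (fun h => ?_) ?_
  · filter_upwards [ae_norm_comp_le hB (hzS h) (hκR h), ae_norm_comp_le hB hz₀S (hκR h)]
      with x hx hx'
    exact (norm_sub_le _ _).trans (add_le_add hx hx')
  · filter_upwards [hlim, ae_all_iff.2 hzS, hz₀S, ae_all_iff.2 hκR] with x hx hxS hxS₀ hxR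
    rw [Metric.tendsto_atTop] at hx ⊢
    intro δ hδ
    obtain ⟨δ', hδ', hd⟩ := huc δ hδ
    obtain ⟨N, hN⟩ := hx δ' hδ'
    refine ⟨N, fun h hh => ?_⟩
    have := hd (z h x, κ h x) ⟨hxS h, hxR h⟩ (z₀ x, κ h x) ⟨hxS₀, hxR h⟩
      (by simpa [Prod.dist_eq, hδ'] using hN h hh)
    simpa [Real.dist_eq] using this

variable [SecondCountableTopology Z]

lemma eventually_integral_le_of_weakStarTendsto_snd (hΦ : Continuous Φ)
    (hconv : ∀ q, ConvexOn ℝ univ fun v => Φ (q, v)) (hS : IsCompact S) (hR : IsCompact R)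
    {z₀ : α → Z} (hz₀ : AEStronglyMeasurable z₀ μ) (hz₀S : ∀ᵐ x ∂μ, z₀ x ∈ S)
    {κ : ℕ → α → En m} {κ₀ : α → En m}
    (hκ : ∀ i, WeakStarTendsto μ (fun h x => κ h x i) (fun x => κ₀ x i))
    (hκR : ∀ h, ∀ᵐ x ∂μ, κ h x ∈ R) (hκ₀R : ∀ᵐ x ∂μ, κ₀ x ∈ R) {ε : ℝ} (hε : 0 < ε) :
    ∀ᶠ h in atTop, ∫ x, Φ (z₀ x, κ₀ x) ∂μ ≤ ∫ x, Φ (z₀ x, κ h x) ∂μ + ε := by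
  have hκm : ∀ h, AEStronglyMeasurable (κ h) μ := fun h =>
    aestronglyMeasurable_of_forall_apply fun i => (hκ i).1 h
  have hκ₀m : AEStronglyMeasurable κ₀ μ :=
    aestronglyMeasurable_of_forall_apply fun i => (hκ i).2
  choose C hC hC₀ using fun i => (hκ i).bounded
  set η : ℝ := ε / (2 * (μ.real univ + 1))
  have hη : 0 < η := by positivity
  have hημ : μ.real univ * η ≤ ε / 2 := by
    rw [mul_div_assoc', div_le_div_iff₀ (by positivity) (by positivity)]
    nlinarith
  borelize Z
  obtain ⟨A, hAm, hA, D, hD⟩ := exists_bounded_measurable_selection (hS.prod hR)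
    (exists_eventually_affine_le hΦ hconv hR hη)
  have hy : AEMeasurable (fun x => (z₀ x, κ₀ x)) μ := (hz₀.prodMk hκ₀m).aemeasurable
  have hψ : ∀ i, Integrable (fun x => A (z₀ x, κ₀ x) i) μ := fun i =>
    Integrable.of_bound ((hAm i).comp_aemeasurable hy).aestronglyMeasurable D (by
      filter_upwards [hz₀S, hκ₀R] with x hx hx' using hD _ ⟨hx, hx'⟩ i)
  generalize hAψ : (fun x => A (z₀ x, κ₀ x)) = ψ at hψ
  have hψA : ∀ x, A (z₀ x, κ₀ x) = ψ x := fun x => congrFun hAψ x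
  replace hψ : ∀ i, Integrable (fun x => ψ x i) μ := fun i => by simpa only [hψA] using hψ i
  have hlin : Tendsto (fun h => ∑ i, (∫ x, κ h x i * ψ x i ∂μ - ∫ x, κ₀ x i * ψ x i ∂μ)) atTop
      (𝓝 0) := by
    rw [← Finset.sum_const_zero (s := (Finset.univ : Finset (Fin m)))]
    exact tendsto_finsetSum _ fun i _ => by
      simpa using ((hκ i).tendsto _ (hψ i)).sub_const (∫ x, κ₀ x i * ψ x i ∂μ)
  filter_upwards [hlin.eventually (lt_mem_nhds (neg_lt_zero.2 (half_pos hε)))] with h h2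
  have hi : ∀ i, Integrable (fun x => κ h x i * ψ x i) μ := fun i =>
    WeakStarTendsto.integrable_mul ((hκ i).1 h) (hC i h) (hψ i)
  have hi₀ : ∀ i, Integrable (fun x => κ₀ x i * ψ x i) μ := fun i =>
    WeakStarTendsto.integrable_mul (hκ i).2 (hC₀ i) (hψ i)
  have hsub : ∀ i, Integrable (fun x => κ h x i * ψ x i - κ₀ x i * ψ x i) μ := fun i =>
    (hi i).sub (hi₀ i)
  have hsum : Integrable (fun x => ∑ i, (κ h x i * ψ x i - κ₀ x i * ψ x i)) μ :=
    integrable_finsetSum _ fun i _ => hsub i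
  have hΦ₀ := integrable_comp_of_isCompact hΦ hS hR hz₀ hκ₀m hz₀S hκ₀R
  have hΦh := integrable_comp_of_isCompact hΦ hS hR hz₀ (hκm h) hz₀S (hκR h)
  have h3 : ∫ x, (Φ (z₀ x, κ₀ x) + ∑ i, (κ h x i * ψ x i - κ₀ x i * ψ x i)) ∂μ ≤
      ∫ x, (Φ (z₀ x, κ h x) + η) ∂μ := by
    refine integral_mono_ae (hΦ₀.add hsum) (hΦh.add (integrable_const _)) ?_
    filter_upwards [hκR h] with x hx
    refine le_trans (le_of_eq ?_) (hA (z₀ x, κ₀ x) (κ h x) hx)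
    rw [hψA]
    congr 1
    exact Finset.sum_congr rfl fun i _ => by ring
  rw [integral_add hΦ₀ hsum, integral_add hΦh (integrable_const _),
    integral_finsetSum _ fun i _ => hsub i, integral_const, smul_eq_mul] at h3
  simp only [integral_sub (hi _) (hi₀ _)] at h3
  linarith

/-- Lower semicontinuity of convex integrands under weak-* convergence. -/
lemma eventually_integral_le_of_weakStarTendsto (hΦ : Continuous Φ)
    (hconv : ∀ q, ConvexOn ℝ univ fun v => Φ (q, v)) (hS : IsCompact S)
    {z : ℕ → α → Z} {z₀ : α → Z}
    (hz : ∀ h, AEStronglyMeasurable (z h) μ) (hz₀ : AEStronglyMeasurable z₀ μ)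
    (hzS : ∀ h, ∀ᵐ x ∂μ, z h x ∈ S) (hz₀S : ∀ᵐ x ∂μ, z₀ x ∈ S)
    (hlim : ∀ᵐ x ∂μ, Tendsto (fun h => z h x) atTop (𝓝 (z₀ x)))
    {κ : ℕ → α → En m} {κ₀ : α → En m}
    (hκ : ∀ i, WeakStarTendsto μ (fun h x => κ h x i) (fun x => κ₀ x i)) :
    (∃ C, ∀ h, ‖∫ x, Φ (z h x, κ h x) ∂μ‖ ≤ C) ∧
    ∀ ε > 0, ∀ᶠ h in atTop, ∫ x, Φ (z₀ x, κ₀ x) ∂μ ≤ ∫ x, Φ (z h x, κ h x) ∂μ + ε := by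
  choose C hC hC₀ using fun i => (hκ i).bounded
  have hR : IsCompact (closedBall (0 : En m) (∑ i, C i)) := isCompact_closedBall _ _
  have hκR : ∀ h, ∀ᵐ x ∂μ, κ h x ∈ closedBall (0 : En m) (∑ i, C i) := fun h => by
    filter_upwards [ae_all_iff.2 fun i => hC i h] with x hx using mem_closedBall_sum hx
  have hκ₀R : ∀ᵐ x ∂μ, κ₀ x ∈ closedBall (0 : En m) (∑ i, C i) := by
    filter_upwards [ae_all_iff.2 hC₀] with x hx using mem_closedBall_sum hx
  have hκm : ∀ h, AEStronglyMeasurable (κ h) μ := fun h =>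
    aestronglyMeasurable_of_forall_apply fun i => (hκ i).1 h
  obtain ⟨B, hB⟩ := (hS.prod hR).exists_bound_of_continuousOn hΦ.continuousOn
  refine ⟨⟨B * μ.real univ, fun h =>
    norm_integral_le_of_norm_le_const (ae_norm_comp_le hB (hzS h) (hκR h))⟩, fun ε hε => ?_⟩
  filter_upwards [(tendsto_integral_sub_of_tendsto_param hΦ hS hR hz hz₀ hκm hzS hz₀S hκR
      hlim).eventually (lt_mem_nhds (neg_lt_zero.2 (half_pos hε))),
    eventually_integral_le_of_weakStarTendsto_snd hΦ hconv hS hR hz₀ hz₀S hκ hκR hκ₀R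
      (half_pos hε)] with h h1 h2
  rw [integral_sub (integrable_comp_of_isCompact hΦ hS hR (hz h) (hκm h) (hzS h) (hκR h))
    (integrable_comp_of_isCompact hΦ hS hR hz₀ (hκm h) hz₀S (hκR h))] at h1
  linarith

end Integrands

lemma continuous_emb (n : ℕ) : Continuous fun p : En (n - 1) × ℝ => emb n p.1 p.2 := by
  refine (PiLp.continuous_toLp 2 fun _ : Fin n => ℝ).comp (continuous_pi fun i => ?_)
  split_ifs <;> fun_prop

lemma le_liminf_of_eventually_le_add {u : ℕ → ℝ} {a : ℝ} (hu : ∃ C, ∀ h, ‖u h‖ ≤ C)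
    (ha : ∀ ε > 0, ∀ᶠ h in atTop, a ≤ u h + ε) : a ≤ liminf u atTop := by
  obtain ⟨C, hC⟩ := hu
  have hbdd : IsBoundedUnder (· ≤ ·) atTop u :=
    isBoundedUnder_of ⟨C, fun h => (le_abs_self _).trans (hC h)⟩
  refine le_of_forall_pos_sub_le fun ε hε => ?_
  refine le_liminf_of_le hbdd.isCoboundedUnder_ge ?_
  filter_upwards [ha ε hε] with h hh
  linarith

theorem graph_curvature_semicontinuity (n : ℕ) (hn : 2 ≤ n)
    (Ω : Set (En (n - 1))) (hΩo : IsOpen Ω) (hΩb : Bornology.IsBounded Ω)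
    (φ : En n × En (n - 1) → ℝ) (hφc : Continuous φ) (hφ0 : ∀ q, 0 ≤ φ q)
    (hφconv : ∀ q : En n, ConvexOn ℝ univ (fun v : En (n - 1) => φ (q, v)))
    (fh : ℕ → En (n - 1) → ℝ) (f : En (n - 1) → ℝ) (c : ℝ)
    (hfhdiff : ∀ h, ∀ x ∈ Ω, DifferentiableAt ℝ (fh h) x)
    (hfdiff : ∀ x ∈ Ω, DifferentiableAt ℝ f x)
    (hbd : ∀ h, ∀ x ∈ Ω, |fh h x| ≤ c ∧ ‖fderiv ℝ (fh h) x‖ ≤ c)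
    (hlip : ∀ h, LipschitzOnWith (Real.toNNReal c) (fun x => fderiv ℝ (fh h) x) Ω)
    (hflip : ∃ C : ℝ≥0, LipschitzOnWith C (fun x => fderiv ℝ f x) Ω)
    (hunif : TendstoUniformlyOn (fun h x => fh h x) f atTop Ω)
    (hunif' : TendstoUniformlyOn (fun h x => fderiv ℝ (fh h) x) (fun x => fderiv ℝ f x)
      atTop Ω)
    (hweak : ∀ ψ : En (n - 1) → ℝ, IntegrableOn ψ Ω → ∀ i j : Fin (n - 1),
      Tendsto (fun h => ∫ x in Ω, pd2 n (fh h) i j x * ψ x) atTop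
        (𝓝 (∫ x in Ω, pd2 n f i j x * ψ x))) :
    ∫ x in Ω, φ (emb n x (f x), Kvec n f x) * Real.sqrt (1 + ‖fderiv ℝ f x‖ ^ 2)
      ≤ liminf (fun h => ∫ x in Ω,
          φ (emb n x (fh h x), Kvec n (fh h) x) * Real.sqrt (1 + ‖fderiv ℝ (fh h) x‖ ^ 2))
        atTop := by
  obtain ⟨C, hC⟩ := hflip
  have hfin : IsFiniteMeasure (volume.restrict Ω) :=
    ⟨by simpa using hΩb.measure_lt_top⟩
  have hlim : ∀ x ∈ Ω, Tendsto (fun h => fderiv ℝ (fh h) x) atTop (𝓝 (fderiv ℝ f x)) :=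
    fun x hx => hunif'.tendsto_at hx
  have hlim₀ : ∀ x ∈ Ω, Tendsto (fun h => fh h x) atTop (𝓝 (f x)) :=
    fun x hx => hunif.tendsto_at hx
  have hfc : ∀ x ∈ Ω, |f x| ≤ c ∧ ‖fderiv ℝ f x‖ ≤ c := fun x hx =>
    ⟨le_of_tendsto' (hlim₀ x hx).abs fun h => (hbd h x hx).1,
      le_of_tendsto' (hlim x hx).norm fun h => (hbd h x hx).2⟩
  have hκ := weakStarTendsto_Kp n hΩo hΩb (fun h x hx => (hbd h x hx).2)
    (fun h => (hlip h).weaken (le_max_left _ C)) (hC.weaken (le_max_right _ C)) hlim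
  obtain ⟨r, hr⟩ := hΩb.subset_closedBall 0
  let Φ : (En n × ℝ) × En (n - 1) → ℝ := fun p => φ (p.1.1, p.2) * |p.1.2|
  have hΦ : Continuous Φ := by fun_prop
  have hconv : ∀ q, ConvexOn ℝ univ fun v => Φ (q, v) := fun q => by
    simpa only [Φ, smul_eq_mul, mul_comm] using (hφconv q.1).smul (abs_nonneg q.2)
  let z : (En (n - 1) → ℝ) → En (n - 1) → En n × ℝ := fun g x =>
    (emb n x (g x), Real.sqrt (1 + ‖fderiv ℝ g x‖ ^ 2))
  let S : Set (En n × ℝ) := ((fun p : En (n - 1) × ℝ => emb n p.1 p.2) ''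
    (closedBall 0 r ×ˢ Icc (-c) c)) ×ˢ Icc 0 (Real.sqrt (1 + c ^ 2))
  have hS : IsCompact S :=
    (((isCompact_closedBall _ _).prod isCompact_Icc).image (continuous_emb n)).prod isCompact_Icc
  have hzm : ∀ g : En (n - 1) → ℝ, (∀ x ∈ Ω, DifferentiableAt ℝ g x) →
      AEStronglyMeasurable (z g) (volume.restrict Ω) := fun g hg => by
    have hgm : AEStronglyMeasurable g (volume.restrict Ω) :=
      ContinuousOn.aestronglyMeasurable
        (fun x hx => (hg x hx).continuousAt.continuousWithinAt) hΩo.measurableSet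
    exact ((continuous_emb n).comp_aestronglyMeasurable
      (aestronglyMeasurable_id.prodMk hgm)).prodMk
      (((measurable_fderiv ℝ g).norm.pow_const 2).const_add 1).sqrt.aestronglyMeasurable
  have hzS : ∀ g : En (n - 1) → ℝ, (∀ x ∈ Ω, |g x| ≤ c ∧ ‖fderiv ℝ g x‖ ≤ c) →
      ∀ᵐ x ∂volume.restrict Ω, z g x ∈ S := fun g hg => by
    filter_upwards [ae_restrict_mem hΩo.measurableSet] with x hx
    refine ⟨⟨(x, g x), ⟨hr hx, abs_le.1 (hg x hx).1⟩, rfl⟩, Real.sqrt_nonneg _,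
      Real.sqrt_le_sqrt ?_⟩
    gcongr
    exact (hg x hx).2
  have hzlim : ∀ᵐ x ∂volume.restrict Ω,
      Tendsto (fun h => z (fh h) x) atTop (𝓝 (z f x)) := by
    filter_upwards [ae_restrict_mem hΩo.measurableSet] with x hx
    refine (((continuous_emb n).tendsto (x, f x)).comp
      (tendsto_const_nhds.prodMk_nhds (hlim₀ x hx))).prodMk_nhds ?_
    exact (((hlim x hx).norm.pow 2).const_add 1).sqrt
  have key := eventually_integral_le_of_weakStarTendsto hΦ hconv hS
    (fun h => hzm (fh h) (hfhdiff h)) (hzm f hfdiff) (fun h => hzS (fh h) (hbd h)) (hzS f hfc)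
    hzlim (κ := fun h => Kvec n (fh h)) (κ₀ := Kvec n f) fun i => hκ (i + 1)
  simp only [Φ, z, abs_of_nonneg (Real.sqrt_nonneg _)] at key
  exact le_liminf_of_eventually_le_add key.1 key.2
end
end
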